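/- Let Ω ⊂ ℝᴺ be a bounded domain (nonempty connected bounded open set) and let K ⊂ Ω be a compact set with C_{ΔLlnL}(K) = 0. Suppose u is continuous on (closure of Ω) ∖ K, twice continuously differentiable on Ω ∖ K, u ≥ 0 on Ω ∖ K, u satisfies −Δu(x) + e^{u(x)} − 1 = 0 for every x ∈ Ω ∖ K, and u = 0 at every point of the boundary ∂Ω. Then u is identically zero on Ω ∖ K. -/

import Mathlib

open MeasureTheory ENNReal

/-- `P*(t) = (|t| + 1)·log(|t| + 1) - |t|`. -/
noncomputable def Pstar (t : ℝ) : ℝ := (|t| + 1) * Real.log (|t| + 1) - |t|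

/-- The Luxemburg norm of `g` relative to the `N`-function `Φ` and measure `ν`:
`inf { k > 0 : ∫ Φ(g/k) dν ≤ 1 }`, with value `∞` if no such `k` exists. -/
noncomputable def luxNorm {X : Type*} [MeasurableSpace X] (Φ : ℝ → ℝ)
    (ν : Measure X) (g : X → ℝ) : ℝ≥0∞ :=
  sInf (ENNReal.ofReal '' {k : ℝ | 0 < k ∧ ∫⁻ x, ENNReal.ofReal (Φ (g x / k)) ∂ν ≤ 1})

/-- The Laplacian of `f : ℝᴺ → ℝ`, as the sum of its second partial derivatives. -/
noncomputable def laplacian {N : ℕ} (f : EuclideanSpace ℝ (Fin N) → ℝ)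
    (x : EuclideanSpace ℝ (Fin N)) : ℝ :=
  ∑ i : Fin N, fderiv ℝ (fun y => fderiv ℝ f y (EuclideanSpace.single i 1)) x
    (EuclideanSpace.single i 1)

/-- The Orlicz capacity `C_{ΔLlnL}(K)` of a set `K` relative to `Ω`:
`inf { ‖Δη‖_{P*} : η ∈ C²_c(Ω), η ≥ 0, η ≥ 1 on a neighborhood of K }`,
where the Luxemburg norm is taken with respect to Lebesgue measure on `Ω`. -/
noncomputable def capDLlnL {N : ℕ} (Ω K : Set (EuclideanSpace ℝ (Fin N))) : ℝ≥0∞ :=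
  sInf { c : ℝ≥0∞ | ∃ η : EuclideanSpace ℝ (Fin N) → ℝ,
    ContDiff ℝ 2 η ∧ HasCompactSupport η ∧ tsupport η ⊆ Ω ∧ (∀ x, 0 ≤ η x) ∧
    (∃ U, IsOpen U ∧ K ⊆ U ∧ ∀ x ∈ U, 1 ≤ η x) ∧
    c = luxNorm Pstar (volume.restrict Ω) (laplacian η) }


section RealFunctions

/-- The primitive of `Real.arsinh` vanishing at `0`, a smooth convex function comparable to
`Pstar`. -/
noncomputable def arsinhPrim (t : ℝ) : ℝ := t * Real.arsinh t - √(1 + t ^ 2) + 1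

theorem arsinhPrim_zero : arsinhPrim 0 = 0 := by simp [arsinhPrim]

theorem hasDerivAt_arsinhPrim (t : ℝ) : HasDerivAt arsinhPrim (Real.arsinh t) t := by
  have hpos : 0 < 1 + t ^ 2 := by positivity
  have h1 : HasDerivAt (fun t : ℝ => 1 + t ^ 2) (2 * t) t := by
    simpa using (hasDerivAt_pow 2 t).const_add 1
  have h2 := h1.sqrt hpos.ne'
  have h3 := (((hasDerivAt_id t).mul (Real.hasDerivAt_arsinh t)).sub h2).add_const 1
  refine (h3.congr_deriv ?_)
  have : √(1 + t ^ 2) ≠ 0 := (Real.sqrt_pos.2 hpos).ne'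
  simp only [id]
  field_simp
  ring

theorem continuous_arsinhPrim : Continuous arsinhPrim :=
  continuous_iff_continuousAt.2 fun t => (hasDerivAt_arsinhPrim t).continuousAt

theorem le_of_hasDerivAt_of_tangent {F : ℝ → ℝ} {S : Set ℝ} (hF : ConvexOn ℝ S F) {a c d : ℝ}
    (ha : a ∈ S) (hc : c ∈ S) (hd : HasDerivAt F d c) : d * (a - c) ≤ F a - F c := by
  rcases lt_trichotomy a c with h | h | h
  · have := hF.slope_le_of_hasDerivAt ha hc h hd
    rw [slope_def_field, div_le_iff₀ (by linarith)] at this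
    linarith
  · simp [h]
  · have := hF.le_slope_of_hasDerivAt hc ha h hd
    rw [slope_def_field, le_div_iff₀ (by linarith)] at this
    linarith

theorem arsinhPrim_bregman (a c : ℝ) :
    (a - c) ^ 2 / (2 * (1 + max |a| |c|)) ≤
      arsinhPrim a - arsinhPrim c - Real.arsinh c * (a - c) := by
  set R := max |a| |c| with hR
  have hR0 : 0 ≤ R := (abs_nonneg a).trans (le_max_left _ _)
  have hd : ∀ t, HasDerivAt (fun t => arsinhPrim t - t ^ 2 / (2 * (1 + R)))
      (Real.arsinh t - t / (1 + R)) t := fun t => by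
    refine ((hasDerivAt_arsinhPrim t).sub ((hasDerivAt_pow 2 t).div_const _)).congr_deriv ?_
    field_simp
    norm_num
    ring
  have hmono : MonotoneOn (fun t => Real.arsinh t - t / (1 + R)) (Set.Icc (-R) R) := by
    have hd2 : ∀ t, HasDerivAt (fun t => Real.arsinh t - t / (1 + R))
        ((√(1 + t ^ 2))⁻¹ - 1 / (1 + R)) t := fun t =>
      (Real.hasDerivAt_arsinh t).sub ((hasDerivAt_id t).div_const _)
    refine monotoneOn_of_deriv_nonneg (convex_Icc _ _)
      (fun t _ => (hd2 t).continuousAt.continuousWithinAt)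
      (fun t _ => (hd2 t).differentiableAt.differentiableWithinAt) fun t ht => ?_
    rw [(hd2 t).deriv, sub_nonneg, one_div]
    have ht' : |t| ≤ R := abs_le.2 ⟨(interior_subset ht).1, (interior_subset ht).2⟩
    refine inv_anti₀ (Real.sqrt_pos.2 (by positivity)) ?_
    rw [Real.sqrt_le_left (by linarith)]
    nlinarith [abs_nonneg t, sq_abs t]
  have hconv : ConvexOn ℝ (Set.Icc (-R) R) (fun t => arsinhPrim t - t ^ 2 / (2 * (1 + R))) := by
    refine MonotoneOn.convexOn_of_deriv (convex_Icc _ _)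
      (fun t _ => (hd t).continuousAt.continuousWithinAt)
      (fun t _ => (hd t).differentiableAt.differentiableWithinAt) ?_
    have : deriv (fun t => arsinhPrim t - t ^ 2 / (2 * (1 + R))) =
        fun t => Real.arsinh t - t / (1 + R) := funext fun t => (hd t).deriv
    rw [this]
    exact hmono.mono interior_subset
  have := le_of_hasDerivAt_of_tangent hconv (a := a) (c := c)
    (abs_le.1 (le_max_left _ _)) (abs_le.1 (le_max_right _ _)) (hd c)
  have h2 : (a - c) ^ 2 / (2 * (1 + R)) =
      a ^ 2 / (2 * (1 + R)) - c ^ 2 / (2 * (1 + R)) - c / (1 + R) * (a - c) := by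
    field_simp
    ring
  rw [h2]
  linarith

theorem arsinhPrim_nonneg (t : ℝ) : 0 ≤ arsinhPrim t := by
  have h := arsinhPrim_bregman t 0
  simp only [arsinhPrim_zero, Real.arsinh_zero] at h
  have : 0 ≤ (t - 0) ^ 2 / (2 * (1 + max |t| |0|)) := by positivity
  linarith

theorem Pstar_zero : Pstar 0 = 0 := by simp [Pstar]

theorem Pstar_abs (t : ℝ) : Pstar |t| = Pstar t := by simp [Pstar]

theorem continuous_Pstar : Continuous Pstar := by
  unfold Pstar
  refine ((continuous_abs.add continuous_const).mul
    ((continuous_abs.add continuous_const).log fun t => ?_)).sub continuous_abs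
  exact (by positivity : (0 : ℝ) < |t| + 1).ne'

theorem hasDerivAt_Pstar {t : ℝ} (ht : 0 < t) : HasDerivAt Pstar (Real.log (1 + t)) t := by
  have h1 : HasDerivAt (fun t : ℝ => (t + 1) * Real.log (t + 1) - t) (Real.log (1 + t)) t := by
    have h0 : HasDerivAt (fun t : ℝ => t + 1) 1 t := (hasDerivAt_id t).add_const 1
    refine ((h0.mul (h0.log (by positivity))).sub (hasDerivAt_id t)).congr_deriv ?_
    field_simp
    rw [add_comm 1 t]
    ring
  refine h1.congr_of_eventuallyEq ?_
  filter_upwards [lt_mem_nhds ht] with s hs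
  simp [Pstar, abs_of_pos hs]

/-- Young's inequality for the pair `exp a - 1 - a`, `Pstar b`. -/
theorem mul_le_exp_add_Pstar (a : ℝ) {b : ℝ} (hb : 0 ≤ b) :
    a * b ≤ (Real.exp a - 1 - a) + Pstar b := by
  have hy : 0 < b + 1 := by linarith
  have h := Real.add_one_le_exp (a - Real.log (b + 1))
  rw [Real.exp_sub, Real.exp_log hy, le_div_iff₀ hy] at h
  simp only [Pstar, abs_of_nonneg hb]
  nlinarith

theorem Pstar_nonneg (t : ℝ) : 0 ≤ Pstar t := by
  have := mul_le_exp_add_Pstar 0 (abs_nonneg t)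
  rw [Pstar_abs] at this
  simpa using this

theorem abs_le_Pstar_add_one (t : ℝ) : |t| ≤ Pstar t + 1 := by
  have := mul_le_exp_add_Pstar 1 (abs_nonneg t)
  rw [Pstar_abs] at this
  have := Real.exp_one_lt_d9
  linarith

theorem Pstar_le_mul_log {t : ℝ} (ht : 0 ≤ t) : Pstar t ≤ t * Real.log (1 + t) := by
  have := Real.log_le_sub_one_of_pos (show 0 < 1 + t by linarith)
  simp only [Pstar, abs_of_nonneg ht, add_comm t 1]
  linarith

theorem Pstar_mono {a b : ℝ} (ha : 0 ≤ a) (hab : a ≤ b) : Pstar a ≤ Pstar b := by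
  have h := mul_le_exp_add_Pstar (Real.log (1 + a)) (ha.trans hab)
  rw [Real.exp_log (by linarith)] at h
  have h2 : 0 ≤ Real.log (1 + a) := Real.log_nonneg (by linarith)
  have h3 := mul_le_mul_of_nonneg_left hab h2
  have h4 : Pstar a = (a + 1) * Real.log (1 + a) - a := by
    simp [Pstar, abs_of_nonneg ha, add_comm]
  rw [h4]
  linarith

theorem nonneg_of_deriv_nonneg {h h' : ℝ → ℝ} (hc : Continuous h) (h0 : h 0 = 0)
    (hd : ∀ t, 0 < t → HasDerivAt h (h' t) t) (hn : ∀ t, 0 < t → 0 ≤ h' t) {t : ℝ} (ht : 0 ≤ t) :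
    0 ≤ h t := by
  have : MonotoneOn h (Set.Ici 0) := by
    refine monotoneOn_of_deriv_nonneg (convex_Ici _) hc.continuousOn
      (fun t ht => ?_) fun t ht => ?_
    · rw [interior_Ici] at ht
      exact (hd t ht).differentiableAt.differentiableWithinAt
    · rw [interior_Ici] at ht
      rw [(hd t ht).deriv]
      exact hn t ht
  simpa [h0] using this Set.self_mem_Ici ht ht

theorem arsinhPrim_le (t : ℝ) : arsinhPrim t ≤ 2 * Pstar t := by
  have heven : arsinhPrim |t| = arsinhPrim t := by
    rcases abs_cases t with h | h <;> simp [arsinhPrim, h.1]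
  rw [← heven, ← Pstar_abs]
  have h := nonneg_of_deriv_nonneg (h := fun t => 2 * Pstar t - arsinhPrim t)
    (h' := fun t => 2 * Real.log (1 + t) - Real.arsinh t)
    ((continuous_Pstar.const_mul 2).sub continuous_arsinhPrim)
    (by simp [Pstar_zero, arsinhPrim_zero])
    (fun t ht => ((hasDerivAt_Pstar ht).const_mul 2).sub (hasDerivAt_arsinhPrim t))
    (fun t ht => by
      rw [sub_nonneg, Real.arsinh, ← Real.log_rpow (by linarith)]
      have hs : √(1 + t ^ 2) ≤ 1 + t := by
        rw [Real.sqrt_le_left (by linarith)]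
        nlinarith
      refine Real.log_le_log (by positivity) ?_
      norm_num
      nlinarith) (abs_nonneg t)
  simpa using h

theorem Pstar_mul_le_sq {l t : ℝ} (hl : 1 ≤ l) (ht : 0 ≤ t) :
    Pstar (l * t) ≤ l ^ 2 * Pstar t := by
  have h := nonneg_of_deriv_nonneg (h := fun t => l ^ 2 * Pstar t - Pstar (l * t))
    (h' := fun t => l ^ 2 * Real.log (1 + t) - Real.log (1 + l * t) * l)
    ((continuous_Pstar.const_mul _).sub (continuous_Pstar.comp (continuous_const.mul continuous_id)))
    (by simp [Pstar_zero])
    (fun t ht => ((hasDerivAt_Pstar ht).const_mul _).sub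
      (HasDerivAt.comp t (hasDerivAt_Pstar (t := l * t) (by positivity))
        (by simpa using (hasDerivAt_id t).const_mul l)))
    (fun t ht => by
      have h1 : 1 + l * t ≤ (1 + t) ^ l := one_add_mul_self_le_rpow_one_add (by linarith) hl
      have h2 : Real.log (1 + l * t) ≤ l * Real.log (1 + t) := by
        rw [← Real.log_rpow (by linarith)]
        exact Real.log_le_log (by positivity) h1
      nlinarith) ht
  simpa using h

theorem Pstar_mul_le {k t : ℝ} (hk : 0 < k) (hk1 : k ≤ 1) (ht : 0 ≤ t) :
    Pstar (k * t) ≤ k * Pstar t := by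
  have h := nonneg_of_deriv_nonneg (h := fun t => k * Pstar t - Pstar (k * t))
    (h' := fun t => k * Real.log (1 + t) - Real.log (1 + k * t) * k)
    ((continuous_Pstar.const_mul _).sub (continuous_Pstar.comp (continuous_const.mul continuous_id)))
    (by simp [Pstar_zero])
    (fun t ht => ((hasDerivAt_Pstar ht).const_mul _).sub
      (HasDerivAt.comp t (hasDerivAt_Pstar (t := k * t) (by positivity))
        (by simpa using (hasDerivAt_id t).const_mul k)))
    (fun t ht => by
      have h2 : Real.log (1 + k * t) ≤ Real.log (1 + t) :=
        Real.log_le_log (by positivity) (by nlinarith)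
      nlinarith) ht
  simpa using h

end RealFunctions

section FiniteMeans

variable {ι : Type*} [Fintype ι]

/-- The arithmetic mean of a finite family of reals. -/
noncomputable def finMean (a : ι → ℝ) : ℝ := (∑ i, a i) / Fintype.card ι

/-- The variance of a finite family of reals. -/
noncomputable def finVar (a : ι → ℝ) : ℝ := finMean fun i => (a i - finMean a) ^ 2

theorem finMean_add (a b : ι → ℝ) : finMean (fun i => a i + b i) = finMean a + finMean b := by
  simp [finMean, Finset.sum_add_distrib, add_div]

theorem finMean_sub (a b : ι → ℝ) : finMean (fun i => a i - b i) = finMean a - finMean b := by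
  simp [finMean, Finset.sum_sub_distrib, sub_div]

theorem finMean_const_mul (c : ℝ) (a : ι → ℝ) : finMean (fun i => c * a i) = c * finMean a := by
  simp [finMean, ← Finset.mul_sum, mul_div_assoc]

theorem finMean_mono {a b : ι → ℝ} (h : ∀ i, a i ≤ b i) : finMean a ≤ finMean b :=
  div_le_div_of_nonneg_right (Finset.sum_le_sum fun i _ => h i) (Nat.cast_nonneg _)

theorem finMean_nonneg {a : ι → ℝ} (h : ∀ i, 0 ≤ a i) : 0 ≤ finMean a :=
  div_nonneg (Finset.sum_nonneg fun i _ => h i) (Nat.cast_nonneg _)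

theorem finVar_nonneg (a : ι → ℝ) : 0 ≤ finVar a := finMean_nonneg fun _ => sq_nonneg _

theorem abs_finMean_le (a : ι → ℝ) : |finMean a| ≤ finMean fun i => |a i| := by
  rw [finMean, finMean, abs_div, abs_of_nonneg (Nat.cast_nonneg (α := ℝ) _)]
  exact div_le_div_of_nonneg_right (Finset.abs_sum_le_sum_abs _ _) (Nat.cast_nonneg _)

theorem finMean_mul_sq_le (a b : ι → ℝ) :
    (finMean fun i => a i * b i) ^ 2 ≤ (finMean fun i => a i ^ 2) * finMean fun i => b i ^ 2 := by
  simp only [finMean, div_pow, div_mul_div_comm, ← sq]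
  exact div_le_div_of_nonneg_right (Finset.sum_mul_sq_le_sq_mul_sq _ _ _) (by positivity)

variable [Nonempty ι]

theorem one_le_card_real : (1 : ℝ) ≤ Fintype.card ι := by
  exact_mod_cast Fintype.card_pos (α := ι)

theorem finMean_const (c : ℝ) : finMean (fun _ : ι => c) = c := by
  simp [finMean]

theorem le_card_mul_finMean {a : ι → ℝ} (h : ∀ i, 0 ≤ a i) (i : ι) :
    a i ≤ Fintype.card ι * finMean a := by
  have : (Fintype.card ι : ℝ) ≠ 0 := by simp
  rw [finMean, mul_div_cancel₀ _ this]
  exact Finset.single_le_sum (fun i _ => h i) (Finset.mem_univ i)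

theorem finMean_sq_sub (a : ι → ℝ) (c : ℝ) :
    finMean (fun i => (a i - c) ^ 2) = finVar a + (finMean a - c) ^ 2 := by
  have h : ∀ d, finMean (fun i => (a i - d) ^ 2) =
      finMean (fun i => a i ^ 2) - 2 * d * finMean a + d ^ 2 := fun d => by
    have : (fun i => (a i - d) ^ 2) = fun i => (a i ^ 2 - 2 * d * a i) + d ^ 2 := by
      ext i; ring
    rw [this, finMean_add, finMean_sub, finMean_const_mul, finMean_const]
  rw [finVar, h, h]
  ring

theorem finVar_eq (a : ι → ℝ) : finVar a = finMean (fun i => a i ^ 2) - finMean a ^ 2 := by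
  have := finMean_sq_sub a 0
  simp only [sub_zero] at this
  linarith

theorem finVar_one_add_abs_le (a : ι → ℝ) : finVar (fun i => 1 + |a i|) ≤ finVar a := by
  have h := finMean_sq_sub (fun i => 1 + |a i|) (1 + |finMean a|)
  have h2 : finMean (fun i => (1 + |a i| - (1 + |finMean a|)) ^ 2) ≤ finVar a := by
    refine finMean_mono fun i => ?_
    rw [add_sub_add_left_eq_sub, sq_le_sq]
    exact abs_abs_sub_abs_le_abs_sub _ _
  nlinarith [sq_nonneg (finMean (fun i => 1 + |a i|) - (1 + |finMean a|))]

theorem finMean_convex_gap (a : ι → ℝ) :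
    finVar a / (2 * (Fintype.card ι * (1 + finMean fun i => |a i|))) ≤
      finMean (fun i => arsinhPrim (a i)) - arsinhPrim (finMean a) := by
  set c := finMean a with hc
  set W := 1 + finMean fun i => |a i| with hW
  have hn := one_le_card_real (ι := ι)
  have hM : 0 ≤ finMean fun i => |a i| := finMean_nonneg fun _ => abs_nonneg _
  have hW1 : 1 ≤ W := by linarith
  have hcW : |c| ≤ finMean fun i => |a i| := abs_finMean_le a
  have key : ∀ i, (a i - c) ^ 2 / (2 * (Fintype.card ι * W)) ≤
      arsinhPrim (a i) - arsinhPrim c - Real.arsinh c * (a i - c) := fun i => by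
    refine le_trans ?_ (arsinhPrim_bregman (a i) c)
    refine div_le_div_of_nonneg_left (sq_nonneg _) (by positivity) ?_
    have h1 : |a i| ≤ Fintype.card ι * finMean fun i => |a i| :=
      le_card_mul_finMean (a := fun i => |a i|) (fun _ => abs_nonneg _) i
    have h2 : max |a i| |c| ≤ Fintype.card ι * finMean fun i => |a i| :=
      max_le h1 (hcW.trans (le_mul_of_one_le_left hM hn))
    rw [hW]
    nlinarith
  have h := finMean_mono key
  rw [finMean_sub, finMean_sub, finMean_const, finMean_const_mul, finMean_sub, finMean_const,
    ← hc, sub_self, mul_zero, sub_zero] at h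
  refine le_trans (le_of_eq ?_) h
  simp only [div_eq_inv_mul, finMean_const_mul, finVar, ← hc]

theorem finMean_weighted_gap (a b : ι → ℝ) {β : ℝ} (hβ : ∀ i, |b i| ≤ β) :
    (1 + finMean fun i => |a i|) * finVar b - 2 * β * √(finVar a * finVar b) ≤
      finMean (fun i => (1 + |a i|) * b i ^ 2) - (1 + |finMean a|) * finMean b ^ 2 := by
  have hβ0 : 0 ≤ β := (abs_nonneg _).trans (hβ (Classical.arbitrary ι))
  set H : ι → ℝ := fun i => 1 + |a i| with hH
  set m := finMean b with hm
  have hmβ : |m| ≤ β := (abs_finMean_le b).trans ((finMean_mono hβ).trans_eq (finMean_const β))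
  have hHm : finMean H = 1 + finMean fun i => |a i| := by rw [hH, finMean_add, finMean_const]
  have hHle : 1 + |finMean a| ≤ finMean H := by rw [hHm]; linarith [abs_finMean_le a]
  have hcs := finMean_mul_sq_le (fun i => H i - finMean H) (fun i => b i ^ 2 - m ^ 2)
  have h1 : finMean (fun i => (H i - finMean H) ^ 2) ≤ finVar a := finVar_one_add_abs_le a
  have h2 : finMean (fun i => (b i ^ 2 - m ^ 2) ^ 2) ≤ (2 * β) ^ 2 * finVar b := by
    rw [finVar, ← finMean_const_mul]
    refine finMean_mono fun i => ?_
    have : |b i + m| ≤ 2 * β := (abs_add_le _ _).trans (by linarith [hβ i])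
    have := sq_le_sq' (abs_le.1 this).1 (abs_le.1 this).2
    nlinarith [sq_nonneg (b i - m)]
  have h3 : (finMean fun i => (H i - finMean H) * (b i ^ 2 - m ^ 2)) ^ 2 ≤
      (2 * β * √(finVar a * finVar b)) ^ 2 := by
    rw [mul_pow, Real.sq_sqrt (mul_nonneg (finVar_nonneg _) (finVar_nonneg _))]
    refine hcs.trans ((mul_le_mul h1 h2 (finMean_nonneg fun _ => sq_nonneg _)
      (finVar_nonneg _)).trans_eq ?_)
    ring
  have h4 := (abs_le.1 (abs_le_of_sq_le_sq h3 (by positivity))).1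
  have h5 : (finMean fun i => (H i - finMean H) * (b i ^ 2 - m ^ 2)) =
      finMean (fun i => H i * b i ^ 2) - finMean H * m ^ 2 - finMean H * finVar b := by
    have : (fun i => (H i - finMean H) * (b i ^ 2 - m ^ 2)) = fun i =>
        (H i * b i ^ 2 - m ^ 2 * H i) - (finMean H * b i ^ 2 - finMean H * m ^ 2) := by
      ext i; ring
    rw [this, finMean_sub, finMean_sub, finMean_sub, finMean_const_mul, finMean_const_mul,
      finMean_const, finVar_eq]
    ring
  rw [h5] at h4
  rw [← hHm]
  nlinarith [mul_le_mul_of_nonneg_right hHle (sq_nonneg m)]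

theorem sqrt_finVar_mul_le (a b : ι → ℝ) {β l : ℝ} (hβ : ∀ i, |b i| ≤ β) (hl : 0 < l)
    (hlβ : 2 * β ≤ l) :
    √(finVar a * finVar b) ≤
      2 * l * Fintype.card ι * (finMean (fun i => arsinhPrim (a i)) - arsinhPrim (finMean a)) +
      (finMean (fun i => (1 + |a i|) * b i ^ 2) - (1 + |finMean a|) * finMean b ^ 2) / l := by
  have hw := finMean_weighted_gap a b hβ
  have hc := finMean_convex_gap a
  set W := 1 + finMean fun i => |a i|
  have hM : 0 ≤ finMean fun i => |a i| := finMean_nonneg fun _ => abs_nonneg _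
  have hW : 0 < W := by positivity
  have hn : 0 < (Fintype.card ι : ℝ) := zero_lt_one.trans_le one_le_card_real
  set q := √(finVar a * finVar b)
  set P := finMean (fun i => arsinhPrim (a i)) - arsinhPrim (finMean a)
  set Q := finMean (fun i => (1 + |a i|) * b i ^ 2) - (1 + |finMean a|) * finMean b ^ 2
  have hq : 2 * q ≤ l * (finVar a / W) + W * finVar b / l := by
    have h1 : 0 ≤ l * (finVar a / W) := mul_nonneg hl.le (div_nonneg (finVar_nonneg _) hW.le)
    have h2 : 0 ≤ W * finVar b / l := div_nonneg (mul_nonneg hW.le (finVar_nonneg _)) hl.le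
    refine abs_le_of_sq_le_sq' ?_ (by positivity) |>.2
    rw [mul_pow, Real.sq_sqrt (mul_nonneg (finVar_nonneg _) (finVar_nonneg _))]
    have h3 : (l * (finVar a / W)) * (W * finVar b / l) = finVar a * finVar b := by
      field_simp
    nlinarith [sq_nonneg (l * (finVar a / W) - W * finVar b / l)]
  have h1 : finVar a / W ≤ 2 * Fintype.card ι * P := by
    rw [div_le_iff₀ (by positivity)] at hc
    rw [div_le_iff₀ hW]
    linarith
  have h2 : W * finVar b / l ≤ Q / l + q := by
    rw [div_le_iff₀ hl, add_mul (Q / l), div_mul_cancel₀ _ hl.ne']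
    have : 2 * β * q ≤ l * q := mul_le_mul_of_nonneg_right hlβ (Real.sqrt_nonneg _)
    linarith
  have h3 := mul_le_mul_of_nonneg_left h1 hl.le
  linarith

theorem abs_sub_finMean_le (a : ι → ℝ) (i : ι) :
    |a i - finMean a| ≤ √(Fintype.card ι * finVar a) := by
  refine Real.abs_le_sqrt ?_
  exact le_card_mul_finMean (a := fun i => (a i - finMean a) ^ 2) (fun _ => sq_nonneg _) i

theorem abs_sub_mul_abs_sub_le (a b : ι → ℝ) (i j k l : ι) :
    |a i - a j| * |b k - b l| ≤ 4 * Fintype.card ι * √(finVar a * finVar b) := by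
  have h : ∀ (a : ι → ℝ) (i j : ι), |a i - a j| ≤ 2 * √(Fintype.card ι * finVar a) :=
    fun a i j => by
      have h1 := abs_sub_finMean_le a i
      have h2 := abs_sub_finMean_le a j
      have h3 := abs_sub_le (a i) (finMean a) (a j)
      rw [abs_sub_comm (finMean a)] at h3
      linarith
  refine (mul_le_mul (h a i j) (h b k l) (abs_nonneg _) (by positivity)).trans_eq ?_
  rw [Real.sqrt_mul (Nat.cast_nonneg _), Real.sqrt_mul (Nat.cast_nonneg _),
    Real.sqrt_mul (finVar_nonneg _)]
  have := Real.mul_self_sqrt (Nat.cast_nonneg (α := ℝ) (Fintype.card ι))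
  linear_combination 4 * √(finVar a) * √(finVar b) * this

end FiniteMeans

set_option linter.unusedSectionVars false

section ShiftMeans

variable {E : Type*} [NormedAddCommGroup E]

/-- Continuous functions with compact support. -/
def IsCC (f : E → ℝ) : Prop := Continuous f ∧ HasCompactSupport f

namespace IsCC

variable {f g : E → ℝ}

theorem add (hf : IsCC f) (hg : IsCC g) : IsCC fun x => f x + g x :=
  ⟨hf.1.add hg.1, hf.2.add hg.2⟩

theorem neg (hf : IsCC f) : IsCC fun x => -f x := ⟨hf.1.neg, hf.2.neg⟩

theorem sub (hf : IsCC f) (hg : IsCC g) : IsCC fun x => f x - g x := by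
  simpa only [sub_eq_add_neg] using hf.add hg.neg

theorem mul_left (hf : Continuous f) (hg : IsCC g) : IsCC fun x => f x * g x :=
  ⟨hf.mul hg.1, hg.2.mul_left⟩

theorem mul (hf : IsCC f) (hg : IsCC g) : IsCC fun x => f x * g x := mul_left hf.1 hg

theorem const_mul (c : ℝ) (hg : IsCC g) : IsCC fun x => c * g x := mul_left continuous_const hg

theorem div_const (hg : IsCC g) (c : ℝ) : IsCC fun x => g x / c := by
  simpa only [div_eq_inv_mul] using hg.const_mul c⁻¹

theorem comp (hf : IsCC f) {φ : ℝ → ℝ} (hφ : Continuous φ) (h0 : φ 0 = 0) :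
    IsCC fun x => φ (f x) := ⟨hφ.comp hf.1, hf.2.comp_left h0⟩

theorem abs (hf : IsCC f) : IsCC fun x => |f x| := hf.comp continuous_abs abs_zero

theorem sq (hf : IsCC f) : IsCC fun x => f x ^ 2 :=
  hf.comp (φ := fun t => t ^ 2) (by fun_prop) (by simp)

theorem shift (hf : IsCC f) (v : E) : IsCC fun x => f (x + v) :=
  ⟨hf.1.comp (by fun_prop), hf.2.comp_homeomorph (Homeomorph.addRight v)⟩

theorem zero : IsCC fun _ : E => (0 : ℝ) := ⟨continuous_const, HasCompactSupport.zero⟩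

theorem sum {κ : Type*} (s : Finset κ) {F : κ → E → ℝ} (hF : ∀ i ∈ s, IsCC (F i)) :
    IsCC fun x => ∑ i ∈ s, F i x := by
  classical
  induction s using Finset.induction_on with
  | empty => simpa using zero
  | insert a s ha ih =>
    simp only [Finset.sum_insert ha]
    exact (hF a (Finset.mem_insert_self _ _)).add
      (ih fun i hi => hF i (Finset.mem_insert_of_mem hi))

theorem integrable [MeasurableSpace E] [BorelSpace E] {μ : Measure E}
    [IsFiniteMeasureOnCompacts μ] (hf : IsCC f) : Integrable f μ :=
  hf.1.integrable_of_hasCompactSupport hf.2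

end IsCC

variable {ι : Type*} [Fintype ι] (z : ι → E)

/-- The average of the translates of `f` by the vectors `z i`. -/
noncomputable def shiftMean (f : E → ℝ) (x : E) : ℝ := finMean fun i => f (x + z i)

theorem IsCC.shiftMean {f : E → ℝ} (hf : IsCC f) : IsCC (shiftMean z f) :=
  (IsCC.sum _ fun i _ => hf.shift (z i)).div_const _

theorem IsCC.iterate_shiftMean {f : E → ℝ} (hf : IsCC f) (k : ℕ) :
    IsCC ((_root_.shiftMean z)^[k] f) := by
  induction k with
  | zero => exact hf
  | succ k ih => rw [Function.iterate_succ_apply']; exact ih.shiftMean z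

theorem shiftMean_sub (f g : E → ℝ) :
    shiftMean z (fun x => f x - g x) = fun x => shiftMean z f x - shiftMean z g x := by
  ext x; exact finMean_sub _ _

theorem shiftMean_const_mul (c : ℝ) (f : E → ℝ) :
    shiftMean z (fun x => c * f x) = fun x => c * shiftMean z f x := by
  ext x; exact finMean_const_mul _ _

theorem shiftMean_shift (f : E → ℝ) (v : E) :
    shiftMean z (fun x => f (x + v)) = fun x => shiftMean z f (x + v) := by
  ext x
  simp only [shiftMean, add_right_comm]

variable [MeasurableSpace E] [BorelSpace E] {μ : Measure E}
  [IsFiniteMeasureOnCompacts μ] [μ.IsAddRightInvariant]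

theorem integral_shiftMean [Nonempty ι] {f : E → ℝ} (hf : IsCC f) :
    ∫ x, shiftMean z f x ∂μ = ∫ x, f x ∂μ := by
  simp only [shiftMean, finMean]
  rw [integral_div, integral_finsetSum _ fun i _ => (hf.shift (z i)).integrable]
  simp only [integral_add_right_eq_self f]
  simp

/-- The bilinear form `∫ δ_w f · δ_{-v} b`, where `δ_v f = f (· + v) - f`. -/
noncomputable def diffForm (μ : Measure E) (v w : E) (f b : E → ℝ) : ℝ :=
  ∫ x, (f (x + w) - f x) * (b (x - v) - b x) ∂μ

theorem diffForm_integrable {f b : E → ℝ} (hf : IsCC f) (hb : IsCC b) (v w : E) :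
    Integrable (fun x => (f (x + w) - f x) * (b (x - v) - b x)) μ := by
  simp only [sub_eq_add_neg _ v]
  exact (((hf.shift w).sub hf).mul ((hb.shift (-v)).sub hb)).integrable

theorem diffForm_sub {f g b : E → ℝ} (hf : IsCC f) (hg : IsCC g) (hb : IsCC b) (v w : E) :
    diffForm μ v w (fun x => f x - g x) b = diffForm μ v w f b - diffForm μ v w g b := by
  rw [diffForm, diffForm, diffForm,
    ← integral_sub (diffForm_integrable hf hb v w) (diffForm_integrable hg hb v w)]
  congr 1
  ext x
  ring

theorem diffForm_const_mul {f b : E → ℝ} (c : ℝ) (v w : E) :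
    diffForm μ v w (fun x => c * f x) b = c * diffForm μ v w f b := by
  rw [diffForm, diffForm, ← integral_const_mul]
  congr 1
  ext x
  ring

theorem integral_shiftMean_mul {f g : E → ℝ} (hf : IsCC f) (hg : IsCC g) {σ : Equiv.Perm ι}
    (hσ : ∀ i, z (σ i) = -z i) :
    ∫ x, shiftMean z f x * g x ∂μ = ∫ x, f x * shiftMean z g x ∂μ := by
  have h1 : ∀ i, ∫ x, f (x + z i) * g x ∂μ = ∫ x, f x * g (x + z (σ i)) ∂μ := fun i => by
    rw [← integral_add_right_eq_self (fun x => f x * g (x + z (σ i))) (z i)]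
    simp [hσ, add_assoc]
  simp only [shiftMean, finMean, div_mul_eq_mul_div, mul_div_assoc', Finset.sum_mul,
    Finset.mul_sum]
  rw [integral_div, integral_div, integral_finsetSum _ fun i _ => ((hf.shift (z i)).mul hg).integrable,
    integral_finsetSum _ fun i _ => (hf.mul (hg.shift (z i))).integrable]
  simp only [h1]
  rw [Equiv.sum_comp σ fun i => ∫ x, f x * g (x + z i) ∂μ]

theorem diffForm_shiftMean {f b : E → ℝ} (hf : IsCC f) (hb : IsCC b) {σ : Equiv.Perm ι}
    (hσ : ∀ i, z (σ i) = -z i) (v w : E) :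
    diffForm μ v w (shiftMean z f) b = diffForm μ v w f (shiftMean z b) := by
  have h := integral_shiftMean_mul (μ := μ) z ((hf.shift w).sub hf) ((hb.shift (-v)).sub hb) hσ
  simp only [shiftMean_sub, shiftMean_shift] at h
  simpa only [diffForm, sub_eq_add_neg _ v] using h

end ShiftMeans

section DiscreteEstimate

variable {E : Type*} [NormedAddCommGroup E] {ι : Type*} [Fintype ι] [Nonempty ι] (z : ι → E)
  [MeasurableSpace E] [BorelSpace E] {μ : Measure E}
  [IsFiniteMeasureOnCompacts μ] [μ.IsAddRightInvariant]

/-- The weighted energy `∫ (1 + |f|) b²`. -/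
noncomputable def weightedEnergy (μ : Measure E) (f b : E → ℝ) : ℝ :=
  ∫ x, (1 + |f x|) * b x ^ 2 ∂μ

theorem IsCC.weighted {f b : E → ℝ} (hf : IsCC f) (hb : IsCC b) :
    IsCC fun x => (1 + |f x|) * b x ^ 2 :=
  IsCC.mul_left (f := fun x => 1 + |f x|) (continuous_const.add hf.1.abs) hb.sq

theorem IsCC.arsinhPrim {f : E → ℝ} (hf : IsCC f) : IsCC fun x => arsinhPrim (f x) :=
  hf.comp continuous_arsinhPrim arsinhPrim_zero

theorem weightedEnergy_nonneg (f b : E → ℝ) : 0 ≤ weightedEnergy μ f b :=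
  integral_nonneg fun x => by positivity

theorem abs_shiftMean_le {b : E → ℝ} {β : ℝ} (hβ : ∀ x, |b x| ≤ β) (x : E) :
    |shiftMean z b x| ≤ β :=
  (abs_finMean_le _).trans ((finMean_mono fun _ => hβ _).trans_eq (finMean_const β))

theorem abs_diffForm_le {f b : E → ℝ} (hf : IsCC f) (hb : IsCC b) {β l : ℝ}
    (hβ : ∀ x, |b x| ≤ β) (hl : 0 < l) (hlβ : 2 * β ≤ l) {v w : E} {i₀ i j : ι}
    (h0 : z i₀ = 0) (hi : z i = w) (hj : z j = -v) :
    |diffForm μ v w f b| ≤ 4 * Fintype.card ι * (2 * l * Fintype.card ι *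
      (∫ x, arsinhPrim (f x) ∂μ - ∫ x, arsinhPrim (shiftMean z f x) ∂μ) +
      (weightedEnergy μ f b - weightedEnergy μ (shiftMean z f) (shiftMean z b)) / l) := by
  have hf' := hf.shiftMean z
  have hb' := hb.shiftMean z
  have hψ := hf.arsinhPrim.shiftMean z
  have hX := (hf.weighted hb).shiftMean z
  have e1 : ∫ x, arsinhPrim (f x) ∂μ - ∫ x, arsinhPrim (shiftMean z f x) ∂μ =
      ∫ x, (shiftMean z (fun x => arsinhPrim (f x)) x - arsinhPrim (shiftMean z f x)) ∂μ := by
    rw [integral_sub hψ.integrable hf'.arsinhPrim.integrable, integral_shiftMean z hf.arsinhPrim]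
  have e2 : weightedEnergy μ f b - weightedEnergy μ (shiftMean z f) (shiftMean z b) =
      ∫ x, (shiftMean z (fun x => (1 + |f x|) * b x ^ 2) x -
        (1 + |shiftMean z f x|) * shiftMean z b x ^ 2) ∂μ := by
    rw [integral_sub hX.integrable (hf'.weighted hb').integrable,
      integral_shiftMean z (hf.weighted hb), weightedEnergy, weightedEnergy]
  rw [e1, e2, ← integral_const_mul, ← integral_div, ← integral_add
    ((hψ.sub hf'.arsinhPrim).const_mul _).integrable
    ((hX.sub (hf'.weighted hb')).div_const _).integrable, ← integral_const_mul]
  refine (abs_integral_le_integral_abs).trans (integral_mono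
    (diffForm_integrable hf hb v w).abs
    ((((hψ.sub hf'.arsinhPrim).const_mul _).add
      ((hX.sub (hf'.weighted hb')).div_const _)).const_mul _).integrable fun x => ?_)
  have h1 := abs_sub_mul_abs_sub_le (fun i => f (x + z i)) (fun i => b (x + z i)) i i₀ j i₀
  have h2 := sqrt_finVar_mul_le (fun i => f (x + z i)) (fun i => b (x + z i))
    (fun i => hβ _) hl hlβ
  simp only [h0, hi, hj, add_zero, ← sub_eq_add_neg] at h1
  rw [abs_mul]
  refine h1.trans (mul_le_mul_of_nonneg_left h2 (by positivity))

theorem abs_diffForm_le_sq {f b : E → ℝ} (hf : IsCC f) (hb : IsCC b) {v w : E} {i₀ i j : ι}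
    (h0 : z i₀ = 0) (hi : z i = w) (hj : z j = -v) :
    |diffForm μ v w f b| ≤ 2 * Fintype.card ι *
      ((∫ x, f x ^ 2 ∂μ - ∫ x, shiftMean z f x ^ 2 ∂μ) +
        (∫ x, b x ^ 2 ∂μ - ∫ x, shiftMean z b x ^ 2 ∂μ)) := by
  have e : ∀ {f : E → ℝ}, IsCC f → ∫ x, f x ^ 2 ∂μ - ∫ x, shiftMean z f x ^ 2 ∂μ =
      ∫ x, (shiftMean z (fun x => f x ^ 2) x - shiftMean z f x ^ 2) ∂μ := fun {f} hf => by
    rw [integral_sub (hf.sq.shiftMean z).integrable (hf.shiftMean z).sq.integrable,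
      integral_shiftMean z hf.sq]
  have hF := fun {f : E → ℝ} (hf : IsCC f) => (hf.sq.shiftMean z).sub (hf.shiftMean z).sq
  rw [e hf, e hb, ← integral_add (hF hf).integrable (hF hb).integrable, ← integral_const_mul]
  refine (abs_integral_le_integral_abs).trans (integral_mono
    (diffForm_integrable hf hb v w).abs (((hF hf).add (hF hb)).const_mul _).integrable fun x => ?_)
  have h1 := abs_sub_mul_abs_sub_le (fun i => f (x + z i)) (fun i => b (x + z i)) i i₀ j i₀
  have h2 : 2 * √(finVar (fun i => f (x + z i)) * finVar fun i => b (x + z i)) ≤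
      finVar (fun i => f (x + z i)) + finVar fun i => b (x + z i) := by
    have ha := finVar_nonneg fun i => f (x + z i)
    have hb := finVar_nonneg fun i => b (x + z i)
    refine (abs_le_of_sq_le_sq' ?_ (by positivity)).2
    rw [mul_pow, Real.sq_sqrt (mul_nonneg ha hb)]
    nlinarith [sq_nonneg (finVar (fun i => f (x + z i)) - finVar fun i => b (x + z i))]
  simp only [h0, hi, hj, add_zero, ← sub_eq_add_neg] at h1
  rw [finVar_eq, finVar_eq (fun i => b (x + z i))] at h2
  rw [finVar_eq, finVar_eq (fun i => b (x + z i))] at h1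
  rw [abs_mul]
  have h3 := mul_le_mul_of_nonneg_left h2 (show 0 ≤ 2 * (Fintype.card ι : ℝ) by positivity)
  simp only [shiftMean]
  linarith

theorem integral_shiftMean_sq_le {f : E → ℝ} (hf : IsCC f) :
    ∫ x, shiftMean z f x ^ 2 ∂μ ≤ ∫ x, f x ^ 2 ∂μ := by
  rw [← integral_shiftMean z hf.sq]
  refine integral_mono (hf.shiftMean z).sq.integrable (hf.sq.shiftMean z).integrable fun x => ?_
  have := finVar_nonneg fun i => f (x + z i)
  rw [finVar_eq] at this
  simp only [shiftMean]
  linarith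

theorem integral_arsinhPrim_shiftMean_le {f : E → ℝ} (hf : IsCC f) :
    ∫ x, arsinhPrim (shiftMean z f x) ∂μ ≤ ∫ x, arsinhPrim (f x) ∂μ := by
  rw [← integral_shiftMean z hf.arsinhPrim]
  refine integral_mono (hf.shiftMean z).arsinhPrim.integrable
    (hf.arsinhPrim.shiftMean z).integrable fun x => ?_
  have h := finMean_convex_gap fun i => f (x + z i)
  have h2 : 0 ≤ finVar (fun i => f (x + z i)) / (2 * (Fintype.card ι *
      (1 + finMean fun i => |f (x + z i)|))) :=
    div_nonneg (finVar_nonneg _) (mul_nonneg zero_le_two (mul_nonneg (Nat.cast_nonneg _)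
      (add_nonneg zero_le_one (finMean_nonneg fun _ => abs_nonneg _))))
  simp only [shiftMean]
  linarith

theorem integral_abs_shiftMean_le {f : E → ℝ} (hf : IsCC f) :
    ∫ x, |shiftMean z f x| ∂μ ≤ ∫ x, |f x| ∂μ := by
  rw [← integral_shiftMean z hf.abs]
  exact integral_mono (hf.shiftMean z).abs.integrable (hf.abs.shiftMean z).integrable
    fun x => abs_finMean_le _

theorem weightedEnergy_le {f b : E → ℝ} (hf : IsCC f) (hb : IsCC b) {β : ℝ}
    (hβ : ∀ x, |b x| ≤ β) :
    weightedEnergy μ f b ≤ ∫ x, b x ^ 2 ∂μ + β ^ 2 * ∫ x, |f x| ∂μ := by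
  rw [weightedEnergy, ← integral_const_mul, ← integral_add hb.sq.integrable
    (hf.abs.const_mul _).integrable]
  refine integral_mono (hf.weighted hb).integrable
    (hb.sq.add (hf.abs.const_mul _)).integrable fun x => ?_
  have := sq_le_sq' (abs_le.1 (hβ x)).1 (abs_le.1 (hβ x)).2
  have := mul_le_mul_of_nonneg_right this (abs_nonneg (f x))
  simp only
  linarith

theorem sum_abs_diffForm_le {f b : E → ℝ} (hf : IsCC f) (hb : IsCC b) {β l : ℝ}
    (hβ : ∀ x, |b x| ≤ β) (hl : 0 < l) (hlβ : 2 * β ≤ l) {v w : E} {i₀ i j : ι}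
    (h0 : z i₀ = 0) (hi : z i = w) (hj : z j = -v) (m : ℕ) :
    ∑ k ∈ Finset.range m,
      |diffForm μ v w ((shiftMean z)^[k] f) ((shiftMean z)^[k] b)| ≤
      4 * Fintype.card ι * (2 * l * Fintype.card ι * (∫ x, arsinhPrim (f x) ∂μ) +
      (∫ x, b x ^ 2 ∂μ + β ^ 2 * ∫ x, |f x| ∂μ) / l) := by
  have hβk : ∀ k x, |(shiftMean z)^[k] b x| ≤ β := fun k => by
    induction k with
    | zero => exact hβ
    | succ k ih => rw [Function.iterate_succ_apply']; exact abs_shiftMean_le z ih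
  set Φ : ℕ → ℝ := fun k => 4 * Fintype.card ι * (2 * l * Fintype.card ι *
      (∫ x, arsinhPrim ((shiftMean z)^[k] f x) ∂μ) +
      weightedEnergy μ ((shiftMean z)^[k] f) ((shiftMean z)^[k] b) / l) with hΦ
  have h1 : ∀ k, |diffForm μ v w ((shiftMean z)^[k] f) ((shiftMean z)^[k] b)| ≤
      Φ k - Φ (k + 1) := fun k => by
    refine (abs_diffForm_le z (hf.iterate_shiftMean z k) (hb.iterate_shiftMean z k) (hβk k) hl hlβ
      h0 hi hj).trans_eq ?_
    simp only [hΦ, Function.iterate_succ_apply']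
    ring
  refine (Finset.sum_le_sum fun k _ => h1 k).trans ?_
  rw [Finset.sum_range_sub']
  have h2 : 0 ≤ Φ m := by
    have := integral_nonneg (μ := μ) (f := fun x => arsinhPrim ((shiftMean z)^[m] f x))
      fun x => arsinhPrim_nonneg _
    have := weightedEnergy_nonneg (μ := μ) ((shiftMean z)^[m] f) ((shiftMean z)^[m] b)
    positivity
  have h3 := weightedEnergy_le (μ := μ) hf hb hβ
  refine (sub_le_self _ h2).trans ?_
  simp only [hΦ, Function.iterate_zero, id]
  gcongr

theorem tendsto_diffForm_iterate {f b : E → ℝ} (hf : IsCC f) (hb : IsCC b) {v w : E} {i₀ i j : ι}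
    (h0 : z i₀ = 0) (hi : z i = w) (hj : z j = -v) :
    Filter.Tendsto (fun k => diffForm μ v w ((shiftMean z)^[k] f) ((shiftMean z)^[k] b))
      Filter.atTop (nhds 0) := by
  have key : ∀ {f : E → ℝ}, IsCC f → Filter.Tendsto (fun k =>
      ∫ x, (shiftMean z)^[k] f x ^ 2 ∂μ - ∫ x, (shiftMean z)^[k + 1] f x ^ 2 ∂μ)
      Filter.atTop (nhds 0) := fun {f} hf => by
    have hanti : Antitone fun k => ∫ x, (shiftMean z)^[k] f x ^ 2 ∂μ := by
      refine antitone_nat_of_succ_le fun k => ?_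
      simp only [Function.iterate_succ_apply']
      exact integral_shiftMean_sq_le z (hf.iterate_shiftMean z k)
    have hbdd : BddBelow (Set.range fun k => ∫ x, (shiftMean z)^[k] f x ^ 2 ∂μ) :=
      ⟨0, by rintro _ ⟨k, rfl⟩; exact integral_nonneg fun x => sq_nonneg _⟩
    have ht := tendsto_atTop_ciInf hanti hbdd
    simpa using ht.sub (ht.comp (Filter.tendsto_add_atTop_nat 1))
  have h := ((key hf).add (key hb)).const_mul (2 * (Fintype.card ι : ℝ))
  rw [add_zero, mul_zero] at h
  refine squeeze_zero_norm (fun k => ?_) h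
  rw [Real.norm_eq_abs]
  refine (abs_diffForm_le_sq z (hf.iterate_shiftMean z k) (hb.iterate_shiftMean z k)
    h0 hi hj).trans_eq ?_
  simp only [Function.iterate_succ_apply']

/-- If the mean of the translates of `η` differs from `η` by `τ g`, then `diffForm v w η b` is
controlled by an `L log L`-type quantity of `g`. -/
theorem abs_diffForm_le_of_shiftMean_sub {η g b : E → ℝ} (hη : IsCC η) (hg : IsCC g) (hb : IsCC b)
    {τ : ℝ} (hτ : 0 ≤ τ) (hηg : ∀ x, shiftMean z η x - η x = τ * g x) {β l : ℝ}
    (hβ : ∀ x, |b x| ≤ β) (hl : 0 < l) (hlβ : 2 * β ≤ l)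
    {σ : Equiv.Perm ι} (hσ : ∀ i, z (σ i) = -z i) {v w : E} {i₀ i j : ι}
    (h0 : z i₀ = 0) (hi : z i = w) (hj : z j = -v) :
    |diffForm μ v w η b| ≤ 8 * Fintype.card ι * τ *
      (2 * l * Fintype.card ι * (∫ x, arsinhPrim (g x) ∂μ) +
      (∫ x, b x ^ 2 ∂μ + β ^ 2 * ∫ x, |g x| ∂μ) / l) := by
  set C := 4 * Fintype.card ι * (2 * l * Fintype.card ι * (∫ x, arsinhPrim (g x) ∂μ) +
      (∫ x, b x ^ 2 ∂μ + β ^ 2 * ∫ x, |g x| ∂μ) / l) with hC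
  have hstep : ∀ k, |diffForm μ v w ((shiftMean z)^[k] η) ((shiftMean z)^[k] b)| ≤
      |diffForm μ v w ((shiftMean z)^[k + 1] η) ((shiftMean z)^[k + 1] b)| +
      τ * (|diffForm μ v w ((shiftMean z)^[k] g) ((shiftMean z)^[k] b)| +
        |diffForm μ v w ((shiftMean z)^[k] (shiftMean z g)) ((shiftMean z)^[k] b)|) := fun k => by
    have hηk := hη.iterate_shiftMean z k
    have hgk := hg.iterate_shiftMean z k
    have hbk := hb.iterate_shiftMean z k
    have hcomm : ∀ k x, shiftMean z ((shiftMean z)^[k] η) x - (shiftMean z)^[k] η x =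
        τ * (shiftMean z)^[k] g x := fun k => by
      induction k with
      | zero => exact hηg
      | succ k ih =>
        intro x
        rw [Function.iterate_succ_apply', Function.iterate_succ_apply']
        have e : (fun x => shiftMean z ((shiftMean z)^[k] η) x - (shiftMean z)^[k] η x) =
          fun x => τ * (shiftMean z)^[k] g x := funext ih
        have := congrFun (congrArg (shiftMean z) e) x
        rwa [shiftMean_sub, shiftMean_const_mul] at this
    have e0 : ∀ k (b' : E → ℝ), IsCC b' → diffForm μ v w ((shiftMean z)^[k] η) b' =
        diffForm μ v w ((shiftMean z)^[k + 1] η) b' -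
          τ * diffForm μ v w ((shiftMean z)^[k] g) b' := fun k b' hb' => by
      rw [← diffForm_const_mul, ← diffForm_sub (hη.iterate_shiftMean z _)
        ((hg.iterate_shiftMean z k).const_mul _) hb']
      congr 1
      ext x
      rw [← hcomm k x, Function.iterate_succ_apply']
      ring
    have e1 : diffForm μ v w ((shiftMean z)^[k + 2] η) ((shiftMean z)^[k] b) =
        diffForm μ v w ((shiftMean z)^[k + 1] η) ((shiftMean z)^[k + 1] b) := by
      rw [Function.iterate_succ_apply', diffForm_shiftMean z (hη.iterate_shiftMean z _) hbk hσ,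
        ← Function.iterate_succ_apply' (shiftMean z)]
    have e2 := e0 k _ hbk
    have e3 := e0 (k + 1) _ hbk
    rw [e3, e1, Function.iterate_succ_apply _ k g] at e2
    rw [e2]
    have a1 := abs_sub (diffForm μ v w ((shiftMean z)^[k + 1] η) ((shiftMean z)^[k + 1] b) -
      τ * diffForm μ v w ((shiftMean z)^[k] (shiftMean z g)) ((shiftMean z)^[k] b))
      (τ * diffForm μ v w ((shiftMean z)^[k] g) ((shiftMean z)^[k] b))
    have a2 := abs_sub (diffForm μ v w ((shiftMean z)^[k + 1] η) ((shiftMean z)^[k + 1] b))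
      (τ * diffForm μ v w ((shiftMean z)^[k] (shiftMean z g)) ((shiftMean z)^[k] b))
    rw [abs_mul, abs_of_nonneg hτ] at a1 a2
    linarith
  have hsum : ∀ m, |diffForm μ v w η b| ≤
      |diffForm μ v w ((shiftMean z)^[m] η) ((shiftMean z)^[m] b)| + τ *
      (∑ k ∈ Finset.range m, |diffForm μ v w ((shiftMean z)^[k] g) ((shiftMean z)^[k] b)| +
       ∑ k ∈ Finset.range m,
        |diffForm μ v w ((shiftMean z)^[k] (shiftMean z g)) ((shiftMean z)^[k] b)|) := fun m => by
    induction m with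
    | zero => simp
    | succ m ih =>
      rw [Finset.sum_range_succ, Finset.sum_range_succ]
      have := hstep m
      linarith
  have hg' : 4 * Fintype.card ι * (2 * l * Fintype.card ι *
      (∫ x, arsinhPrim (shiftMean z g x) ∂μ) +
      (∫ x, b x ^ 2 ∂μ + β ^ 2 * ∫ x, |shiftMean z g x| ∂μ) / l) ≤ C := by
    have h1 := integral_arsinhPrim_shiftMean_le (μ := μ) z hg
    have h2 := integral_abs_shiftMean_le (μ := μ) z hg
    rw [hC]
    gcongr
  have hbound : ∀ m, |diffForm μ v w η b| ≤
      |diffForm μ v w ((shiftMean z)^[m] η) ((shiftMean z)^[m] b)| + τ * (C + C) := fun m =>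
    (hsum m).trans <| by
      have h1 := sum_abs_diffForm_le (μ := μ) z hg hb hβ hl hlβ h0 hi hj m
      have h2 := (sum_abs_diffForm_le (μ := μ) z (hg.shiftMean z) hb hβ hl hlβ h0 hi hj m).trans hg'
      gcongr
  have ht := (tendsto_diffForm_iterate (μ := μ) z hη hb h0 hi hj).abs.add_const (τ * (C + C))
  rw [abs_zero, zero_add] at ht
  refine (ge_of_tendsto' ht hbound).trans_eq ?_
  rw [hC]
  ring

end DiscreteEstimate

section SecondDifferences

/-- The `i`-th partial derivative. -/
noncomputable def partialD {N : ℕ} (i : Fin N) (f : EuclideanSpace ℝ (Fin N) → ℝ)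
    (x : EuclideanSpace ℝ (Fin N)) : ℝ :=
  fderiv ℝ f x (EuclideanSpace.single i 1)

variable {E : Type*} [NormedAddCommGroup E]

/-- Pointwise bounded convergence `q n → G` of continuous functions, with all supports in a
common compact set. -/
structure BddApprox (q : ℕ → E → ℝ) (G : E → ℝ) : Prop where
  cont : ∀ n, Continuous (q n)
  lim : ∀ x, Filter.Tendsto (fun n => q n x) Filter.atTop (nhds (G x))
  bound : ∃ C, ∀ n x, |q n x| ≤ C
  supp : ∃ S, IsCompact S ∧ ∀ n x, x ∉ S → q n x = 0

namespace BddApprox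

variable {q q' : ℕ → E → ℝ} {G G' : E → ℝ}

theorem add (h : BddApprox q G) (h' : BddApprox q' G') :
    BddApprox (fun n x => q n x + q' n x) fun x => G x + G' x := by
  obtain ⟨C, hC⟩ := h.bound
  obtain ⟨C', hC'⟩ := h'.bound
  obtain ⟨S, hS, hSq⟩ := h.supp
  obtain ⟨S', hS', hSq'⟩ := h'.supp
  refine ⟨fun n => (h.cont n).add (h'.cont n), fun x => (h.lim x).add (h'.lim x),
    ⟨C + C', fun n x => (abs_add_le _ _).trans (add_le_add (hC n x) (hC' n x))⟩,
    S ∪ S', hS.union hS', fun n x hx => ?_⟩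
  rw [Set.mem_union, not_or] at hx
  rw [hSq n x hx.1, hSq' n x hx.2, add_zero]

theorem zero : BddApprox (fun _ _ => 0 : ℕ → E → ℝ) fun _ => 0 :=
  ⟨fun _ => continuous_const, fun _ => tendsto_const_nhds, ⟨0, by simp⟩, ∅, isCompact_empty,
    by simp⟩

theorem sum {κ : Type*} (s : Finset κ) {q : κ → ℕ → E → ℝ} {G : κ → E → ℝ}
    (h : ∀ i ∈ s, BddApprox (q i) (G i)) :
    BddApprox (fun n x => ∑ i ∈ s, q i n x) fun x => ∑ i ∈ s, G i x := by
  classical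
  induction s using Finset.induction_on with
  | empty => simpa using zero
  | insert a s ha ih =>
    simp only [Finset.sum_insert ha]
    exact (h a (Finset.mem_insert_self _ _)).add
      (ih fun i hi => h i (Finset.mem_insert_of_mem hi))

theorem comp (h : BddApprox q G) {φ : ℝ → ℝ} (hφ : Continuous φ) (h0 : φ 0 = 0) :
    BddApprox (fun n x => φ (q n x)) fun x => φ (G x) := by
  obtain ⟨C, hC⟩ := h.bound
  obtain ⟨S, hS, hSq⟩ := h.supp
  obtain ⟨M, hM⟩ := (isCompact_Icc (a := -C) (b := C)).exists_bound_of_continuousOn hφ.continuousOn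
  refine ⟨fun n => hφ.comp (h.cont n), fun x => (hφ.tendsto _).comp (h.lim x),
    ⟨M, fun n x => hM _ (abs_le.1 (hC n x))⟩, S, hS, fun n x hx => ?_⟩
  rw [hSq n x hx, h0]

theorem mul_left (h : BddApprox q G) {b : E → ℝ} (hb : IsCC b) :
    BddApprox (fun n x => b x * q n x) fun x => b x * G x := by
  obtain ⟨C, hC⟩ := h.bound
  obtain ⟨S, hS, hSq⟩ := h.supp
  obtain ⟨M, hM⟩ := hb.2.exists_bound_of_continuous hb.1
  refine ⟨fun n => hb.1.mul (h.cont n), fun x => (h.lim x).const_mul _,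
    ⟨M * C, fun n x => ?_⟩, S, hS, fun n x hx => ?_⟩
  · rw [abs_mul]
    exact mul_le_mul (hM x) (hC n x) (abs_nonneg _) ((norm_nonneg _).trans (hM x))
  · rw [hSq n x hx, mul_zero]

theorem isCC (h : BddApprox q G) (n : ℕ) : IsCC (q n) := by
  obtain ⟨S, hS, hSq⟩ := h.supp
  exact ⟨h.cont n, HasCompactSupport.intro hS fun x hx => hSq n x hx⟩

theorem tendsto_integral [MeasurableSpace E] [BorelSpace E] {μ : Measure E}
    [IsFiniteMeasureOnCompacts μ] (h : BddApprox q G) :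
    Filter.Tendsto (fun n => ∫ x, q n x ∂μ) Filter.atTop (nhds (∫ x, G x ∂μ)) := by
  obtain ⟨C, hC⟩ := h.bound
  obtain ⟨S, hS, hSq⟩ := h.supp
  refine tendsto_integral_of_dominated_convergence (S.indicator fun _ => C)
    (fun n => (h.isCC n).integrable.aestronglyMeasurable) ?_ (fun n => ?_)
    (Filter.Eventually.of_forall h.lim)
  · rw [integrable_indicator_iff hS.measurableSet]
    exact integrableOn_const hS.measure_lt_top.ne
  · refine Filter.Eventually.of_forall fun x => ?_
    by_cases hx : x ∈ S
    · simpa [hx] using hC n x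
    · simp [hx, hSq n x hx]

end BddApprox

theorem bddApprox_of_exists_near [ProperSpace E] {q : ℕ → E → ℝ} {G : E → ℝ} (hG : IsCC G)
    (hq : ∀ n, Continuous (q n)) {R : ℝ} {r : ℕ → ℝ} (hr : ∀ n, r n ≤ 1) (hR : 0 ≤ R)
    (hr0 : Filter.Tendsto r Filter.atTop (nhds 0))
    (h : ∀ n x, ∃ y, dist y x ≤ r n * R ∧ q n x = G y) : BddApprox q G := by
  choose y hy hqy using h
  refine ⟨hq, fun x => ?_, ?_, Metric.cthickening R (tsupport G),
    hG.2.isCompact.cthickening, fun n x hx => ?_⟩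
  · simp only [hqy]
    refine (hG.1.tendsto x).comp (tendsto_iff_dist_tendsto_zero.2 ?_)
    exact squeeze_zero (fun n => dist_nonneg) (fun n => hy n x) (by simpa using hr0.mul_const R)
  · obtain ⟨M, hM⟩ := hG.2.exists_bound_of_continuous hG.1
    exact ⟨M, fun n x => by rw [hqy]; exact hM _⟩
  · rw [hqy]
    by_contra hne
    refine hx (Metric.mem_cthickening_of_dist_le x (y n x) R _ (subset_tsupport _ hne) ?_)
    rw [dist_comm]
    exact (hy n x).trans (mul_le_of_le_one_left hR (hr n))

variable [NormedSpace ℝ E]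

theorem exists_second_difference_eq {f : E → ℝ} (hf : ContDiff ℝ 2 f) (v w x : E) {r : ℝ}
    (hr : 0 < r) : ∃ y, dist y x ≤ r * (‖v‖ + ‖w‖) ∧
      (f (x + r • v + r • w) - f (x + r • v) - f (x + r • w) + f x) / r ^ 2 =
        fderiv ℝ (fun y => fderiv ℝ f y v) y w := by
  have hd : Differentiable ℝ f := hf.differentiable (by norm_num)
  have hd2 : Differentiable ℝ fun y => fderiv ℝ f y v :=
    ((hf.fderiv_right (m := 1) (by norm_num)).clm_apply contDiff_const).differentiable (by norm_num)
  have hline : ∀ (g : E → ℝ), Differentiable ℝ g → ∀ (a u : E) (s : ℝ),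
      HasDerivAt (fun s : ℝ => g (a + s • u)) (fderiv ℝ g (a + s • u) u) s := fun g hg a u s => by
    have h1 : HasDerivAt (fun s : ℝ => a + s • u) u s := by
      simpa using ((hasDerivAt_id s).smul_const u).const_add a
    exact (hg (a + s • u)).hasFDerivAt.comp_hasDerivAt s h1
  have h1 : ∀ s, HasDerivAt (fun s : ℝ => f ((x + r • w) + s • v) - f (x + s • v))
      (fderiv ℝ f ((x + r • w) + s • v) v - fderiv ℝ f (x + s • v) v) s := fun s =>
    (hline f hd _ v s).sub (hline f hd x v s)
  obtain ⟨s, hs, hs'⟩ := exists_hasDerivAt_eq_slope _ _ hr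
    (fun s _ => (h1 s).continuousAt.continuousWithinAt) fun s _ => h1 s
  have h2 := hline _ hd2 (x + s • v) w
  obtain ⟨t, ht, ht'⟩ := exists_hasDerivAt_eq_slope _ _ hr
    (fun s _ => (h2 s).continuousAt.continuousWithinAt) fun s _ => h2 s
  refine ⟨x + s • v + t • w, ?_, ?_⟩
  · rw [dist_eq_norm, show x + s • v + t • w - x = s • v + t • w by abel]
    refine (norm_add_le _ _).trans ?_
    rw [norm_smul, norm_smul, Real.norm_eq_abs, Real.norm_eq_abs, abs_of_pos hs.1, abs_of_pos ht.1,
      mul_add]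
    gcongr
    exacts [hs.2.le, ht.2.le]
  · rw [ht']
    simp only [sub_zero, zero_smul, add_zero] at hs' ⊢
    rw [show x + s • v + r • w = x + r • w + s • v by abel, hs',
      show x + r • w + r • v = x + r • v + r • w by abel]
    field_simp
    ring

theorem bddApprox_second_difference [FiniteDimensional ℝ E] {f : E → ℝ} (hf : ContDiff ℝ 2 f)
    (hc : HasCompactSupport f) (v w : E) {r : ℕ → ℝ} (hr : ∀ n, r n ≤ 1) (hr' : ∀ n, 0 < r n)
    (hr0 : Filter.Tendsto r Filter.atTop (nhds 0)) :
    BddApprox (fun n x =>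
      (f (x + r n • v + r n • w) - f (x + r n • v) - f (x + r n • w) + f x) / r n ^ 2)
      fun y => fderiv ℝ (fun y => fderiv ℝ f y v) y w := by
  have := FiniteDimensional.proper_real E
  have h1 : ContDiff ℝ 1 fun y => fderiv ℝ f y v :=
    (hf.fderiv_right (m := 1) (by norm_num)).clm_apply contDiff_const
  have hcf := hf.continuous
  refine bddApprox_of_exists_near (R := ‖v‖ + ‖w‖) (r := r)
    ⟨(h1.continuous_fderiv (by norm_num)).clm_apply continuous_const, ?_⟩
    (fun n => by fun_prop) hr (by positivity) hr0
    fun n x => exists_second_difference_eq hf v w x (hr' n)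
  exact (hc.fderiv_apply (𝕜 := ℝ) v).fderiv_apply (𝕜 := ℝ) w

end SecondDifferences

section MixedDerivativeEstimate

variable {N : ℕ}

/-- The vectors `0`, `r eᵢ`, `-r eᵢ`. -/
noncomputable def axisShift (r : ℝ) : Option (Fin N × Bool) → EuclideanSpace ℝ (Fin N)
  | none => 0
  | some (i, true) => r • EuclideanSpace.single i 1
  | some (i, false) => -(r • EuclideanSpace.single i 1)

/-- The permutation of the index set of `axisShift` that corresponds to negation. -/
def axisFlip : Equiv.Perm (Option (Fin N × Bool)) :=
  Equiv.optionCongr (Equiv.prodCongr (Equiv.refl _) Equiv.boolNot)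

theorem axisShift_axisFlip (r : ℝ) (i : Option (Fin N × Bool)) :
    axisShift r (axisFlip i) = -axisShift r i := by
  rcases i with _ | ⟨i, _ | _⟩ <;> simp [axisShift, axisFlip]

theorem card_axis : (Fintype.card (Option (Fin N × Bool)) : ℝ) = 2 * N + 1 := by
  simp [Fintype.card_option, Fintype.card_prod, mul_comm]

/-- The second difference of `f` in the directions `v`, `w`, with step `r`. -/
noncomputable def secondDiff {E : Type*} [NormedAddCommGroup E] [NormedSpace ℝ E] (v w : E) (r : ℝ)
    (f : E → ℝ) (x : E) : ℝ :=
  (f (x + r • v + r • w) - f (x + r • v) - f (x + r • w) + f x) / r ^ 2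

/-- The discrete Laplacian with step `r`. -/
noncomputable def discreteLaplacian (r : ℝ) (f : EuclideanSpace ℝ (Fin N) → ℝ)
    (x : EuclideanSpace ℝ (Fin N)) : ℝ :=
  ∑ i : Fin N, -secondDiff (EuclideanSpace.single i 1) (-EuclideanSpace.single i 1) r f x

theorem shiftMean_axisShift_sub {r : ℝ} (hr : 0 < r) (f : EuclideanSpace ℝ (Fin N) → ℝ)
    (x : EuclideanSpace ℝ (Fin N)) :
    shiftMean (axisShift r) f x - f x = r ^ 2 / (2 * N + 1) * discreteLaplacian r f x := by
  have hN : (2 * N + 1 : ℝ) ≠ 0 := by positivity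
  have h1 : ∀ i : Fin N, -secondDiff (EuclideanSpace.single i 1) (-EuclideanSpace.single i 1) r f x =
      (f (x + r • EuclideanSpace.single i 1) + f (x + -(r • EuclideanSpace.single i 1)) - 2 * f x) /
        r ^ 2 := fun i => by
    rw [secondDiff, smul_neg, add_neg_cancel_right]
    ring
  rw [shiftMean, finMean, card_axis, Fintype.sum_option, Fintype.sum_prod_type, discreteLaplacian]
  simp only [h1, Fintype.sum_bool, axisShift, add_zero, ← Finset.sum_div, Finset.sum_sub_distrib,
    Finset.sum_const, Finset.card_univ, Fintype.card_fin, nsmul_eq_mul]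
  field_simp
  ring

theorem diffForm_eq_integral_secondDiff {f b : EuclideanSpace ℝ (Fin N) → ℝ} (hf : IsCC f)
    (hb : IsCC b) (v w : EuclideanSpace ℝ (Fin N)) {r : ℝ} (hr : 0 < r) :
    diffForm volume (r • v) (r • w) f b = r ^ 2 * ∫ x, b x * secondDiff v w r f x := by
  have hδ := (hf.shift (r • w)).sub hf
  have h1 : diffForm volume (r • v) (r • w) f b =
      (∫ x, (f (x + r • w) - f x) * b (x - r • v)) - ∫ x, (f (x + r • w) - f x) * b x := by
    rw [← integral_sub _ (hδ.mul hb).integrable]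
    · simp only [diffForm, mul_sub]
    · simpa only [sub_eq_add_neg _ (r • v)] using (hδ.mul (hb.shift (-(r • v)))).integrable
  have h2 : ∫ x, (f (x + r • w) - f x) * b (x - r • v) =
      ∫ x, (f (x + r • v + r • w) - f (x + r • v)) * b x := by
    rw [← integral_add_right_eq_self (fun x => (f (x + r • w) - f x) * b (x - r • v)) (r • v)]
    simp
  rw [h1, h2, ← integral_sub _ (hδ.mul hb).integrable, ← integral_const_mul]
  · congr 1
    ext x
    rw [secondDiff]
    field_simp
    ring
  · have := ((hf.shift (r • w)).shift (r • v)).sub (hf.shift (r • v))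
    exact (this.mul hb).integrable

theorem IsCC.secondDiff {f : EuclideanSpace ℝ (Fin N) → ℝ} (hf : IsCC f)
    (v w : EuclideanSpace ℝ (Fin N)) (r : ℝ) : IsCC (secondDiff v w r f) :=
  (((((hf.shift (r • w)).shift (r • v)).sub (hf.shift (r • v))).sub
    (hf.shift (r • w))).add hf).div_const _

theorem abs_integral_mul_secondDiff_le {f b : EuclideanSpace ℝ (Fin N) → ℝ} (hf : IsCC f)
    (hb : IsCC b) {β l : ℝ} (hβ : ∀ x, |b x| ≤ β) (hl : 0 < l) (hlβ : 2 * β ≤ l) (i j : Fin N)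
    {r : ℝ} (hr : 0 < r) :
    |∫ x, b x * secondDiff (EuclideanSpace.single i 1) (EuclideanSpace.single j 1) r f x| ≤
      8 * (2 * l * (2 * N + 1) * (∫ x, arsinhPrim (discreteLaplacian r f x)) +
      ((∫ x, b x ^ 2) + β ^ 2 * ∫ x, |discreteLaplacian r f x|) / l) := by
  have hg : IsCC (discreteLaplacian r f) := IsCC.sum _ fun i _ => (hf.secondDiff _ _ _).neg
  have h := abs_diffForm_le_of_shiftMean_sub (μ := volume) (axisShift r) hf hg hb
    (τ := r ^ 2 / (2 * N + 1)) (by positivity) (shiftMean_axisShift_sub hr f) hβ hl hlβ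
    (axisShift_axisFlip r) (v := r • EuclideanSpace.single i 1)
    (w := r • EuclideanSpace.single j 1) (i₀ := none) (i := some (j, true)) (j := some (i, false))
    rfl rfl rfl
  rw [diffForm_eq_integral_secondDiff hf hb _ _ hr, card_axis, abs_mul,
    abs_of_nonneg (sq_nonneg r)] at h
  have hN : (2 * N + 1 : ℝ) ≠ 0 := by positivity
  refine le_of_mul_le_mul_left (h.trans_eq ?_) (pow_pos hr 2)
  field_simp

/-- A weak-type estimate for mixed second derivatives in terms of the Laplacian. -/
theorem abs_integral_mul_partialD_le {f b : EuclideanSpace ℝ (Fin N) → ℝ} (hf : ContDiff ℝ 2 f)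
    (hc : HasCompactSupport f) (hb : IsCC b) {β l : ℝ} (hβ : ∀ x, |b x| ≤ β) (hl : 0 < l)
    (hlβ : 2 * β ≤ l) (i j : Fin N) :
    |∫ x, b x * partialD j (partialD i f) x| ≤
      8 * (2 * l * (2 * N + 1) * (∫ x, arsinhPrim (laplacian f x)) +
      ((∫ x, b x ^ 2) + β ^ 2 * ∫ x, |laplacian f x|) / l) := by
  set r : ℕ → ℝ := fun n => 1 / ((n : ℝ) + 1) with hrdef
  have hr1 : ∀ n, r n ≤ 1 := fun n => by
    rw [hrdef, div_le_one (by positivity)]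
    linarith [Nat.cast_nonneg (α := ℝ) n]
  have hr0 : ∀ n, 0 < r n := fun n => by positivity
  have hrt : Filter.Tendsto r Filter.atTop (nhds 0) := tendsto_one_div_add_atTop_nhds_zero_nat
  have happ := fun v w => bddApprox_second_difference hf hc v w hr1 hr0 hrt
  have hlap : BddApprox (fun n => discreteLaplacian (r n) f) (laplacian f) := by
    have := BddApprox.sum Finset.univ fun (i : Fin N) _ =>
      (happ (EuclideanSpace.single i 1) (-EuclideanSpace.single i 1)).comp continuous_neg neg_zero
    simp only [map_neg, neg_neg] at this
    exact this
  refine le_of_tendsto_of_tendsto' ((happ _ _).mul_left hb).tendsto_integral.abs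
    (((((hlap.comp continuous_arsinhPrim arsinhPrim_zero).tendsto_integral).const_mul _).add
      ((((hlap.comp continuous_abs abs_zero).tendsto_integral.const_mul _).const_add _).div_const
        _)).const_mul _) fun n => ?_
  exact abs_integral_mul_secondDiff_le ⟨hf.continuous, hc⟩ hb hβ hl hlβ i j (hr0 n)

end MixedDerivativeEstimate

section LineDerivatives

variable {E : Type*} [NormedAddCommGroup E] [NormedSpace ℝ E]

theorem HasLineDerivAt.mul_real {f g : E → ℝ} {f' g' : ℝ} {x v : E}
    (hf : HasLineDerivAt ℝ f f' x v) (hg : HasLineDerivAt ℝ g g' x v) :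
    HasLineDerivAt ℝ (fun y => f y * g y) (f' * g x + f x * g') x v := by
  simpa [HasLineDerivAt] using HasDerivAt.fun_mul hf hg

theorem HasLineDerivAt.sub_real {f g : E → ℝ} {f' g' : ℝ} {x v : E}
    (hf : HasLineDerivAt ℝ f f' x v) (hg : HasLineDerivAt ℝ g g' x v) :
    HasLineDerivAt ℝ (fun y => f y - g y) (f' - g') x v := HasDerivAt.fun_sub hf hg

theorem HasLineDerivAt.sum_real {κ : Type*} {s : Finset κ} {f : κ → E → ℝ} {f' : κ → ℝ} {x v : E}
    (hf : ∀ i ∈ s, HasLineDerivAt ℝ (f i) (f' i) x v) :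
    HasLineDerivAt ℝ (fun y => ∑ i ∈ s, f i y) (∑ i ∈ s, f' i) x v := HasDerivAt.fun_sum hf

theorem HasLineDerivAt.comp_real {f : E → ℝ} {φ : ℝ → ℝ} {f' φ' : ℝ} {x v : E}
    (hφ : HasDerivAt φ φ' (f x)) (hf : HasLineDerivAt ℝ f f' x v) :
    HasLineDerivAt ℝ (fun y => φ (f y)) (φ' * f') x v := by
  have h : HasDerivAt φ φ' (f (x + (0 : ℝ) • v)) := by simpa using hφ
  exact HasDerivAt.comp (0 : ℝ) h hf

theorem integral_eq_zero_of_hasLineDerivAt [FiniteDimensional ℝ E] [MeasurableSpace E]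
    [BorelSpace E] {μ : Measure E} [μ.IsAddHaarMeasure] {F F' : E → ℝ} {v : E}
    (hF : Integrable F μ) (hF' : Integrable F' μ)
    (h : ∀ x, HasLineDerivAt ℝ F (F' x) x v) : ∫ x, F' x ∂μ = 0 := by
  have := integral_bilinear_hasLineDerivAt_right_eq_neg_left_of_integrable (μ := μ)
    (f := fun _ : E => (1 : ℝ)) (f' := fun _ => 0) (g := F) (g' := F') (v := v)
    (B := ContinuousLinearMap.mul ℝ ℝ) (by simp) (by simpa using hF') (by simpa using hF)
    (fun x _ => hasDerivAt_const _ _) fun x _ => h x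
  simpa using this

variable {N : ℕ}

theorem ContDiff.partialD {f : EuclideanSpace ℝ (Fin N) → ℝ} (hf : ContDiff ℝ 2 f) (i : Fin N) :
    ContDiff ℝ 1 (partialD i f) :=
  (hf.fderiv_right (m := 1) (by norm_num)).clm_apply contDiff_const

theorem continuous_partialD {f : EuclideanSpace ℝ (Fin N) → ℝ} (hf : ContDiff ℝ 1 f) (i : Fin N) :
    Continuous (partialD i f) :=
  (hf.continuous_fderiv (by norm_num)).clm_apply continuous_const

theorem hasCompactSupport_partialD {f : EuclideanSpace ℝ (Fin N) → ℝ} (hf : HasCompactSupport f)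
    (i : Fin N) : HasCompactSupport (partialD i f) :=
  hf.fderiv_apply (𝕜 := ℝ) _

theorem hasLineDerivAt_partialD {f : EuclideanSpace ℝ (Fin N) → ℝ}
    {x : EuclideanSpace ℝ (Fin N)} (hf : DifferentiableAt ℝ f x) (i : Fin N) :
    HasLineDerivAt ℝ f (partialD i f x) x (EuclideanSpace.single i 1) :=
  hf.hasFDerivAt.hasLineDerivAt _

/-- The squared norm of the gradient. -/
noncomputable def gradSq (f : EuclideanSpace ℝ (Fin N) → ℝ) (x : EuclideanSpace ℝ (Fin N)) : ℝ :=
  ∑ i, partialD i f x ^ 2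

theorem gradSq_nonneg (f : EuclideanSpace ℝ (Fin N) → ℝ) (x : EuclideanSpace ℝ (Fin N)) :
    0 ≤ gradSq f x := Finset.sum_nonneg fun _ _ => sq_nonneg _

theorem sq_partialD_le (f : EuclideanSpace ℝ (Fin N) → ℝ) (x : EuclideanSpace ℝ (Fin N))
    (i : Fin N) : partialD i f x ^ 2 ≤ gradSq f x :=
  Finset.single_le_sum (f := fun i => partialD i f x ^ 2) (fun _ _ => sq_nonneg _)
    (Finset.mem_univ i)

theorem laplacian_eq (f : EuclideanSpace ℝ (Fin N) → ℝ) (x : EuclideanSpace ℝ (Fin N)) :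
    laplacian f x = ∑ i, partialD i (partialD i f) x := rfl

theorem isCC_partialD {f : EuclideanSpace ℝ (Fin N) → ℝ} (hf : ContDiff ℝ 2 f)
    (hc : HasCompactSupport f) (i : Fin N) : IsCC (partialD i f) :=
  ⟨(hf.partialD i).continuous, hasCompactSupport_partialD hc i⟩

theorem isCC_partialD_partialD {f : EuclideanSpace ℝ (Fin N) → ℝ} (hf : ContDiff ℝ 2 f)
    (hc : HasCompactSupport f) (i j : Fin N) : IsCC (partialD j (partialD i f)) :=
  ⟨continuous_partialD (hf.partialD i) j,
    hasCompactSupport_partialD (hasCompactSupport_partialD hc i) j⟩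

theorem isCC_laplacian {f : EuclideanSpace ℝ (Fin N) → ℝ} (hf : ContDiff ℝ 2 f)
    (hc : HasCompactSupport f) : IsCC (laplacian f) :=
  IsCC.sum _ fun i _ => isCC_partialD_partialD hf hc i i

theorem isCC_gradSq {f : EuclideanSpace ℝ (Fin N) → ℝ} (hf : ContDiff ℝ 2 f)
    (hc : HasCompactSupport f) : IsCC (gradSq f) :=
  IsCC.sum _ fun i _ => (isCC_partialD hf hc i).sq

theorem hasLineDerivAt_gradSq {f : EuclideanSpace ℝ (Fin N) → ℝ} (hf : ContDiff ℝ 2 f)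
    (x : EuclideanSpace ℝ (Fin N)) (i : Fin N) :
    HasLineDerivAt ℝ (gradSq f) (∑ j, 2 * partialD j f x * partialD i (partialD j f) x) x
      (EuclideanSpace.single i 1) := by
  refine HasLineDerivAt.sum_real fun j _ => ?_
  refine HasLineDerivAt.comp_real (φ := fun t => t ^ 2) ?_
    (hasLineDerivAt_partialD ((hf.partialD j).differentiable (by norm_num) x) i)
  simpa using hasDerivAt_pow 2 (partialD j f x)

end LineDerivatives

section GradientEstimate

variable {N : ℕ} {f : EuclideanSpace ℝ (Fin N) → ℝ}

theorem hasLineDerivAt_inv_one_add (hf : ContDiff ℝ 2 f) (h0 : ∀ x, 0 ≤ f x)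
    (x : EuclideanSpace ℝ (Fin N)) (i : Fin N) :
    HasLineDerivAt ℝ (fun y => (1 + f y)⁻¹) (-((1 + f x)⁻¹ ^ 2) * partialD i f x) x
      (EuclideanSpace.single i 1) := by
  have hpos : 1 + f x ≠ 0 := by linarith [h0 x]
  refine HasLineDerivAt.comp_real (φ := fun t => (1 + t)⁻¹) ?_
    (hasLineDerivAt_partialD (hf.differentiable (by norm_num) x) i)
  refine (((hasDerivAt_id (f x)).const_add 1).inv hpos).congr_deriv ?_
  simp only [id]
  field_simp

theorem continuous_inv_one_add (hf : Continuous f) (h0 : ∀ x, 0 ≤ f x) :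
    Continuous fun x => (1 + f x)⁻¹ :=
  (continuous_const.add hf).inv₀ fun x => (add_pos_of_pos_of_nonneg one_pos (h0 x)).ne'

theorem inv_one_add_mem (h0 : ∀ x, 0 ≤ f x) (x : EuclideanSpace ℝ (Fin N)) :
    0 < (1 + f x)⁻¹ ∧ (1 + f x)⁻¹ ≤ 1 :=
  ⟨inv_pos.2 (by linarith [h0 x]), inv_le_one_of_one_le₀ (by linarith [h0 x])⟩

theorem integral_gradSq_le (hf : ContDiff ℝ 2 f) (hc : HasCompactSupport f) (h0 : ∀ x, 0 ≤ f x) :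
    ∫ x, (1 + f x)⁻¹ ^ 2 * gradSq f x ≤ ∫ x, |laplacian f x| := by
  have hω := continuous_inv_one_add hf.continuous h0
  have hi : ∀ i, IsCC fun x => -((1 + f x)⁻¹ ^ 2) * partialD i f x * partialD i f x +
      (1 + f x)⁻¹ * partialD i (partialD i f) x := fun i =>
    (IsCC.mul (IsCC.mul_left (hω.pow 2).neg (isCC_partialD hf hc i)) (isCC_partialD hf hc i)).add
      (IsCC.mul_left hω (isCC_partialD_partialD hf hc i i))
  have hz : ∀ i, ∫ x, (-((1 + f x)⁻¹ ^ 2) * partialD i f x * partialD i f x +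
      (1 + f x)⁻¹ * partialD i (partialD i f) x) = 0 := fun i =>
    integral_eq_zero_of_hasLineDerivAt (F := fun x => (1 + f x)⁻¹ * partialD i f x)
      (IsCC.mul_left hω (isCC_partialD hf hc i)).integrable (hi i).integrable fun x =>
      (hasLineDerivAt_inv_one_add hf h0 x i).mul_real
        (hasLineDerivAt_partialD ((hf.partialD i).differentiable (by norm_num) x) i)
  have hs : ∫ x, ((1 + f x)⁻¹ * laplacian f x - (1 + f x)⁻¹ ^ 2 * gradSq f x) = 0 := by
    rw [← Finset.sum_const_zero (s := (Finset.univ : Finset (Fin N))),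
      ← Finset.sum_congr rfl fun i _ => hz i, ← integral_finsetSum _ fun i _ => (hi i).integrable]
    congr 1
    ext x
    rw [laplacian_eq, gradSq, Finset.mul_sum, Finset.mul_sum, ← Finset.sum_sub_distrib]
    refine Finset.sum_congr rfl fun i _ => ?_
    ring
  have i1 : IsCC fun x => (1 + f x)⁻¹ * laplacian f x := IsCC.mul_left hω (isCC_laplacian hf hc)
  have i2 : IsCC fun x => (1 + f x)⁻¹ ^ 2 * gradSq f x :=
    IsCC.mul_left (hω.pow 2) (isCC_gradSq hf hc)
  rw [integral_sub i1.integrable i2.integrable] at hs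
  have : ∫ x, (1 + f x)⁻¹ * laplacian f x ≤ ∫ x, |laplacian f x| := by
    refine integral_mono i1.integrable (isCC_laplacian hf hc).abs.integrable fun x => ?_
    obtain ⟨h1, h2⟩ := inv_one_add_mem h0 x
    exact (mul_le_mul_of_nonneg_left (le_abs_self _) h1.le).trans
      (mul_le_of_le_one_left (abs_nonneg _) h2)
  linarith

/-- An `L log L` estimate for the squared gradient of `log (1 + f)`. -/
theorem integral_gradSq_log_le (hf : ContDiff ℝ 2 f) (hc : HasCompactSupport f)
    (h0 : ∀ x, 0 ≤ f x) :
    ∫ x, (1 + f x)⁻¹ ^ 2 * gradSq f x * Real.log (1 + (1 + f x)⁻¹ ^ 2 * gradSq f x) ≤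
      (128 * (2 * N + 1) * N ^ 2 + 1) * ((∫ x, Pstar (laplacian f x)) + ∫ x, |laplacian f x|) := by
  set ω : EuclideanSpace ℝ (Fin N) → ℝ := fun x => (1 + f x)⁻¹ with hωdef
  set L : EuclideanSpace ℝ (Fin N) → ℝ := fun x => Real.log (1 + ω x ^ 2 * gradSq f x) with hL
  set b : Fin N → Fin N → EuclideanSpace ℝ (Fin N) → ℝ := fun i j x =>
    2 * ω x ^ 3 * (1 + ω x ^ 2 * gradSq f x)⁻¹ * (partialD i f x * partialD j f x) with hb
  have hω : Continuous ω := continuous_inv_one_add hf.continuous h0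
  have hω1 : ∀ x, 0 < ω x ∧ ω x ≤ 1 := inv_one_add_mem h0
  have hW : ∀ x, 0 ≤ ω x ^ 2 * gradSq f x := fun x => mul_nonneg (sq_nonneg _) (gradSq_nonneg _ _)
  have hs := isCC_gradSq hf hc
  have hd := isCC_partialD hf hc
  have hdd := isCC_partialD_partialD hf hc
  have hlap := isCC_laplacian hf hc
  have hWc : IsCC fun x => ω x ^ 2 * gradSq f x := IsCC.mul_left (hω.pow 2) hs
  have hinv : Continuous fun x => (1 + ω x ^ 2 * gradSq f x)⁻¹ :=
    (continuous_const.add hWc.1).inv₀ fun x => (add_pos_of_pos_of_nonneg one_pos (hW x)).ne'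
  have hLc : Continuous L :=
    (continuous_const.add hWc.1).log fun x => (add_pos_of_pos_of_nonneg one_pos (hW x)).ne'
  have hbc : ∀ i j, IsCC (b i j) := fun i j =>
    IsCC.mul_left ((continuous_const.mul (hω.pow 3)).mul hinv) ((hd i).mul (hd j))
  have hbabs : ∀ i j x, |b i j x| ≤ 2 ∧ b i j x ^ 2 ≤ 4 * (ω x ^ 2 * gradSq f x) := by
    intro i j x
    have h1 : |partialD i f x * partialD j f x| ≤ gradSq f x := by
      rw [abs_le]
      have hi := sq_partialD_le f x i
      have hj := sq_partialD_le f x j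
      constructor <;> nlinarith [sq_nonneg (partialD i f x - partialD j f x),
        sq_nonneg (partialD i f x + partialD j f x)]
    set W := ω x ^ 2 * gradSq f x with hWx
    have hWx0 : 0 ≤ W := hW x
    obtain ⟨ho, ho1⟩ := hω1 x
    have h2 : |b i j x| ≤ 2 * (W / (1 + W)) := by
      rw [hb]
      simp only
      rw [abs_mul, abs_of_nonneg (by positivity)]
      calc 2 * ω x ^ 3 * (1 + W)⁻¹ * |partialD i f x * partialD j f x|
          ≤ 2 * ω x ^ 3 * (1 + W)⁻¹ * gradSq f x := by gcongr
        _ = ω x * (2 * (W / (1 + W))) := by rw [hWx]; field_simp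
        _ ≤ 2 * (W / (1 + W)) := mul_le_of_le_one_left (by positivity) ho1
    have h3 : W / (1 + W) ≤ 1 := by rw [div_le_one (by positivity)]; linarith
    have h4 : W / (1 + W) ≤ W := div_le_self hWx0 (by linarith)
    have h5 : 0 ≤ W / (1 + W) := by positivity
    refine ⟨by linarith, ?_⟩
    rw [← sq_abs]
    nlinarith [abs_nonneg (b i j x)]
  -- the divergence of the field `ω L ∇f`
  set dL : Fin N → EuclideanSpace ℝ (Fin N) → ℝ := fun i x => (1 + ω x ^ 2 * gradSq f x)⁻¹ *
    (2 * ω x * (-(ω x ^ 2) * partialD i f x) * gradSq f x +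
      ω x ^ 2 * ∑ j, 2 * partialD j f x * partialD i (partialD j f) x) with hdL
  have hdLc : ∀ i, Continuous (dL i) := fun i =>
    hinv.mul ((((continuous_const.mul hω).mul ((hω.pow 2).neg.mul (hd i).1)).mul hs.1).add
      ((hω.pow 2).mul (continuous_finsetSum _ fun j _ =>
        (continuous_const.mul (hd j).1).mul (hdd j i).1)))
  have hLd : ∀ i x, HasLineDerivAt ℝ L (dL i x) x (EuclideanSpace.single i 1) := fun i x => by
    have h1 : HasLineDerivAt ℝ (fun y => ω y ^ 2) (2 * ω x * (-(ω x ^ 2) * partialD i f x)) x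
        (EuclideanSpace.single i 1) :=
      HasLineDerivAt.comp_real (φ := fun t => t ^ 2) (by simpa using hasDerivAt_pow 2 (ω x))
        (hasLineDerivAt_inv_one_add hf h0 x i)
    refine HasLineDerivAt.comp_real (φ := fun t => Real.log (1 + t))
      (f := fun y => ω y ^ 2 * gradSq f y) ?_ (h1.mul_real (hasLineDerivAt_gradSq hf x i))
    have := ((hasDerivAt_id (ω x ^ 2 * gradSq f x)).const_add 1).log (by
      have := hW x
      simp only [id]
      linarith)
    simpa using this
  have hF : ∀ i, IsCC fun x => ω x * L x * partialD i f x := fun i =>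
    IsCC.mul_left (hω.mul hLc) (hd i)
  have hF' : ∀ i, IsCC fun x => (-(ω x ^ 2) * partialD i f x * L x + ω x * dL i x) *
      partialD i f x + ω x * L x * partialD i (partialD i f) x := fun i =>
    (IsCC.mul_left ((((hω.pow 2).neg.mul (hd i).1).mul hLc).add (hω.mul (hdLc i))) (hd i)).add
      (IsCC.mul_left (hω.mul hLc) (hdd i i))
  have hz : ∀ i, ∫ x, ((-(ω x ^ 2) * partialD i f x * L x + ω x * dL i x) *
      partialD i f x + ω x * L x * partialD i (partialD i f) x) = 0 := fun i =>
    integral_eq_zero_of_hasLineDerivAt (hF i).integrable (hF' i).integrable fun x =>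
      ((hasLineDerivAt_inv_one_add hf h0 x i).mul_real (hLd i x)).mul_real
        (hasLineDerivAt_partialD ((hf.partialD i).differentiable (by norm_num) x) i)
  have hmix : IsCC fun x => ∑ i, ∑ j, b j i x * partialD i (partialD j f) x :=
    IsCC.sum _ fun i _ => IsCC.sum _ fun j _ => (hbc j i).mul (hdd j i)
  have hsum : ∀ x, ∑ i, ((-(ω x ^ 2) * partialD i f x * L x + ω x * dL i x) *
      partialD i f x + ω x * L x * partialD i (partialD i f) x) =
      -(ω x ^ 2 * gradSq f x * L x) -
        2 * (ω x ^ 2 * gradSq f x) ^ 2 * (1 + ω x ^ 2 * gradSq f x)⁻¹ +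
        (∑ i, ∑ j, b j i x * partialD i (partialD j f) x) + ω x * L x * laplacian f x := by
    intro x
    have e1 : ∀ i, (-(ω x ^ 2) * partialD i f x * L x + ω x * dL i x) *
        partialD i f x + ω x * L x * partialD i (partialD i f) x =
        (-(ω x ^ 2 * L x) - 2 * ω x ^ 4 * gradSq f x * (1 + ω x ^ 2 * gradSq f x)⁻¹) *
          partialD i f x ^ 2 + (∑ j, b j i x * partialD i (partialD j f) x) +
        ω x * L x * partialD i (partialD i f) x := fun i => by
      have e2 : ∑ j, b j i x * partialD i (partialD j f) x =
          ω x ^ 3 * (1 + ω x ^ 2 * gradSq f x)⁻¹ * partialD i f x *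
            ∑ j, 2 * partialD j f x * partialD i (partialD j f) x := by
        rw [Finset.mul_sum]
        refine Finset.sum_congr rfl fun j _ => ?_
        rw [hb]
        ring
      rw [e2, hdL]
      ring
    rw [Finset.sum_congr rfl fun i _ => e1 i, Finset.sum_add_distrib, Finset.sum_add_distrib,
      ← Finset.mul_sum, ← Finset.mul_sum, ← laplacian_eq, ← gradSq]
    ring
  have hzero : ∫ x, ∑ i, ((-(ω x ^ 2) * partialD i f x * L x + ω x * dL i x) *
      partialD i f x + ω x * L x * partialD i (partialD i f) x) = 0 := by
    rw [integral_finsetSum _ fun i _ => (hF' i).integrable]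
    exact Finset.sum_eq_zero fun i _ => hz i
  have hmain : IsCC fun x => ω x ^ 2 * gradSq f x * L x := by
    simpa only [mul_comm] using IsCC.mul_left hLc hWc
  have hP : IsCC fun x => Pstar (laplacian f x) := hlap.comp continuous_Pstar Pstar_zero
  have hbound : ∀ x, ω x ^ 2 * gradSq f x * L x ≤
      (∑ i, ∑ j, b j i x * partialD i (partialD j f) x) +
        (ω x ^ 2 * gradSq f x + Pstar (laplacian f x)) -
      ∑ i, ((-(ω x ^ 2) * partialD i f x * L x + ω x * dL i x) *
        partialD i f x + ω x * L x * partialD i (partialD i f) x) := fun x => by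
    rw [hsum]
    have h1 : 0 ≤ 2 * (ω x ^ 2 * gradSq f x) ^ 2 * (1 + ω x ^ 2 * gradSq f x)⁻¹ := by
      have := hW x
      positivity
    have hL0 : 0 ≤ L x := Real.log_nonneg (by linarith [hW x])
    have h2 : ω x * L x * laplacian f x ≤ L x * |laplacian f x| := by
      have := mul_le_mul_of_nonneg_left (le_abs_self (laplacian f x))
        (mul_nonneg (hω1 x).1.le hL0)
      refine this.trans ?_
      rw [mul_assoc]
      exact mul_le_of_le_one_left (by positivity) (hω1 x).2
    have h3 := mul_le_exp_add_Pstar (L x) (abs_nonneg (laplacian f x))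
    rw [Pstar_abs, hL, Real.exp_log (by linarith [hW x])] at h3
    linarith
  have hle := integral_mono (μ := volume) (hmain.integrable (μ := volume))
    ((hmix.add (hWc.add hP)).sub (IsCC.sum _ fun i _ => hF' i)).integrable hbound
  rw [integral_sub (hmix.add (hWc.add hP)).integrable
    (IsCC.sum _ fun i _ => hF' i).integrable, hzero, sub_zero,
    integral_add hmix.integrable (hWc.add hP).integrable,
    integral_add hWc.integrable hP.integrable, integral_finsetSum _ fun i _ =>
      (IsCC.sum _ fun j _ => (hbc j i).mul (hdd j i)).integrable] at hle
  have hgrad : ∫ x, ω x ^ 2 * gradSq f x ≤ ∫ x, |laplacian f x| := integral_gradSq_le hf hc h0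
  have hPn : 0 ≤ ∫ x, Pstar (laplacian f x) := integral_nonneg fun x => Pstar_nonneg _
  have hAn : 0 ≤ ∫ x, |laplacian f x| := integral_nonneg fun x => abs_nonneg _
  have hψ : ∫ x, arsinhPrim (laplacian f x) ≤ 2 * ∫ x, Pstar (laplacian f x) := by
    rw [← integral_const_mul]
    exact integral_mono hlap.arsinhPrim.integrable (hP.const_mul 2).integrable
      fun x => arsinhPrim_le _
  have hij : ∀ i j, ∫ x, b j i x * partialD i (partialD j f) x ≤
      128 * (2 * N + 1) * ((∫ x, Pstar (laplacian f x)) + ∫ x, |laplacian f x|) := fun i j => by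
    refine (le_abs_self _).trans ((abs_integral_mul_partialD_le hf hc (hbc j i) (β := 2) (l := 4)
      (fun x => (hbabs j i x).1) (by norm_num) (by norm_num) j i).trans ?_)
    have hb2 : ∫ x, b j i x ^ 2 ≤ 4 * ∫ x, |laplacian f x| := by
      refine le_trans ?_ (mul_le_mul_of_nonneg_left hgrad zero_le_four)
      rw [← integral_const_mul]
      exact integral_mono (hbc j i).sq.integrable (hWc.const_mul 4).integrable
        fun x => (hbabs j i x).2
    have hN : (0 : ℝ) ≤ N := Nat.cast_nonneg _
    have := mul_le_mul_of_nonneg_left hψ (show (0 : ℝ) ≤ 2 * N + 1 by positivity)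
    nlinarith [mul_nonneg hN hAn, mul_nonneg hN hPn]
  have htot : ∑ i, ∫ x, ∑ j, b j i x * partialD i (partialD j f) x ≤
      N ^ 2 * (128 * (2 * N + 1) * ((∫ x, Pstar (laplacian f x)) + ∫ x, |laplacian f x|)) := by
    have : ∀ i, ∫ x, ∑ j, b j i x * partialD i (partialD j f) x ≤
        N * (128 * (2 * N + 1) * ((∫ x, Pstar (laplacian f x)) + ∫ x, |laplacian f x|)) :=
      fun i => by
        rw [integral_finsetSum _ fun j _ => ((hbc j i).mul (hdd j i)).integrable]
        refine (Finset.sum_le_sum fun j _ => hij i j).trans_eq (by simp)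
    refine (Finset.sum_le_sum fun i _ => this i).trans_eq ?_
    simp
    ring
  linarith

end GradientEstimate

section Truncations

open Set

theorem hasDerivAt_comp_max {r r' : ℝ → ℝ} (hr : ∀ t, 0 ≤ t → HasDerivAt r (r' t) t)
    (h0 : r' 0 = 0) (t : ℝ) : HasDerivAt (fun t => r (max t 0)) (r' (max t 0)) t := by
  rcases lt_trichotomy t 0 with ht | rfl | ht
  · rw [max_eq_right ht.le, h0]
    refine (hasDerivAt_const t (r 0)).congr_of_eventuallyEq ?_
    filter_upwards [Iio_mem_nhds ht] with s hs
    rw [max_eq_right (le_of_lt hs)]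
  · rw [max_self, h0]
    have h1 : HasDerivWithinAt (fun t => r (max t 0)) 0 (Iic 0) 0 :=
      (hasDerivWithinAt_const 0 _ (r 0)).congr (fun s hs => by rw [max_eq_right hs]) (by simp)
    have h2 : HasDerivWithinAt (fun t => r (max t 0)) 0 (Ici 0) 0 := by
      have := (hr 0 le_rfl).hasDerivWithinAt (s := Ici 0)
      rw [h0] at this
      exact this.congr (fun s hs => by rw [max_eq_left hs]) (by simp)
    simpa [Iic_union_Ici] using h1.union h2
  · rw [max_eq_left ht.le]
    refine (hr t ht.le).congr_of_eventuallyEq ?_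
    filter_upwards [Ioi_mem_nhds ht] with s hs
    rw [max_eq_left (le_of_lt hs)]

theorem hasDerivAt_max_one_sub_pow (n : ℕ) (t : ℝ) :
    HasDerivAt (fun t => max (1 - t) 0 ^ (n + 2)) (-((n + 2) * max (1 - t) 0 ^ (n + 1))) t := by
  have h := hasDerivAt_comp_max (r := fun t => t ^ (n + 2)) (r' := fun t => (n + 2) * t ^ (n + 1))
    (fun t _ => by simpa using hasDerivAt_pow (n + 2) t) (by simp) (1 - t)
  have h2 := HasDerivAt.comp t h ((hasDerivAt_id t).const_sub 1)
  exact h2.congr_deriv (by ring)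

/-- A convex `C²` regularization of the positive part. -/
noncomputable def smoothPos (t : ℝ) : ℝ := max t 0 ^ 3 / (1 + max t 0) ^ 2

/-- The derivative of `smoothPos`. -/
noncomputable def smoothPosDeriv (t : ℝ) : ℝ :=
  (max t 0 ^ 3 + 3 * max t 0 ^ 2) / (1 + max t 0) ^ 3

/-- The second derivative of `smoothPos`. -/
noncomputable def smoothPosDerivTwo (t : ℝ) : ℝ := 6 * max t 0 / (1 + max t 0) ^ 4

theorem hasDerivAt_smoothPos (t : ℝ) : HasDerivAt smoothPos (smoothPosDeriv t) t := by
  refine hasDerivAt_comp_max (r := fun t => t ^ 3 / (1 + t) ^ 2)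
    (r' := fun t => (t ^ 3 + 3 * t ^ 2) / (1 + t) ^ 3) (fun t ht => ?_) (by simp) t
  have hne : 1 + t ≠ 0 := by positivity
  refine ((hasDerivAt_pow 3 t).div (((hasDerivAt_id t).const_add 1).fun_pow 2)
    (pow_ne_zero _ hne)).congr_deriv ?_
  simp only [id]
  field_simp
  push_cast
  ring

theorem hasDerivAt_smoothPosDeriv (t : ℝ) :
    HasDerivAt smoothPosDeriv (smoothPosDerivTwo t) t := by
  refine hasDerivAt_comp_max (r := fun t => (t ^ 3 + 3 * t ^ 2) / (1 + t) ^ 3)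
    (r' := fun t => 6 * t / (1 + t) ^ 4) (fun t ht => ?_) (by simp) t
  have hne : 1 + t ≠ 0 := by positivity
  refine (((hasDerivAt_pow 3 t).add ((hasDerivAt_pow 2 t).const_mul 3)).div
    (((hasDerivAt_id t).const_add 1).fun_pow 3) (pow_ne_zero _ hne)).congr_deriv ?_
  simp only [id, Pi.add_apply]
  field_simp
  push_cast
  ring

theorem continuous_smoothPosDerivTwo : Continuous smoothPosDerivTwo := by
  unfold smoothPosDerivTwo
  refine Continuous.div (by fun_prop) (by fun_prop) fun t => pow_ne_zero _ ?_
  have := le_max_right t 0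
  linarith

theorem smoothPos_nonneg (t : ℝ) : 0 ≤ smoothPos t := by
  have := le_max_right t 0
  unfold smoothPos
  positivity

theorem smoothPosDeriv_nonneg (t : ℝ) : 0 ≤ smoothPosDeriv t := by
  have := le_max_right t 0
  unfold smoothPosDeriv
  positivity

theorem smoothPosDerivTwo_nonneg (t : ℝ) : 0 ≤ smoothPosDerivTwo t := by
  have := le_max_right t 0
  unfold smoothPosDerivTwo
  positivity

theorem smoothPos_of_nonpos {t : ℝ} (ht : t ≤ 0) : smoothPos t = 0 := by
  simp [smoothPos, max_eq_right ht]

theorem smoothPosDeriv_of_nonpos {t : ℝ} (ht : t ≤ 0) : smoothPosDeriv t = 0 := by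
  simp [smoothPosDeriv, max_eq_right ht]

theorem smoothPosDerivTwo_of_nonpos {t : ℝ} (ht : t ≤ 0) : smoothPosDerivTwo t = 0 := by
  simp [smoothPosDerivTwo, max_eq_right ht]

theorem smoothPosDeriv_pos {t : ℝ} (ht : 0 < t) : 0 < smoothPosDeriv t := by
  rw [smoothPosDeriv, max_eq_left ht.le]
  positivity

theorem exp_smoothPos_sub_one_le (t : ℝ) :
    Real.exp (smoothPos t) - 1 ≤ smoothPosDeriv t * (Real.exp t - 1) := by
  rcases le_total t 0 with ht | ht
  · simp [smoothPos_of_nonpos ht, smoothPosDeriv_of_nonpos ht]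
  have h0 := smoothPosDeriv_nonneg t
  have h1 : smoothPosDeriv t ≤ 1 := by
    rw [smoothPosDeriv, max_eq_left ht, div_le_one (by positivity)]
    nlinarith
  have h2 : smoothPos t ≤ smoothPosDeriv t * t := by
    rw [smoothPos, smoothPosDeriv, max_eq_left ht, div_mul_eq_mul_div,
      div_le_div_iff₀ (by positivity) (by positivity)]
    have : 0 ≤ 2 * t ^ 3 * (1 + t) ^ 2 := by positivity
    nlinarith
  have h3 := convexOn_exp.2 (mem_univ t) (mem_univ 0) h0 (sub_nonneg.2 h1)
    (add_sub_cancel _ _)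
  simp only [smul_eq_mul, mul_zero, add_zero, Real.exp_zero, mul_one] at h3
  have := Real.exp_le_exp.2 h2
  linarith

theorem young_cutoff {q c s W L : ℝ} (hq : 0 ≤ q) (hq1 : q ≤ 1) (hc : 0 ≤ c) (hs : 0 ≤ s)
    (hW : 0 ≤ W) (hsW : 0 < q → s ≤ 4 * W) :
    c * (12 * q ^ 2 * s - 4 * q ^ 3 * L) ≤ q ^ 4 * (Real.exp c - 1 - c) / 2 +
      9216 * (W * Real.log (1 + W)) + 64 * Pstar L := by
  have hlog : 0 ≤ Real.log (1 + W) := Real.log_nonneg (by linarith)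
  rcases hq.eq_or_lt with rfl | hq0
  · have := mul_nonneg hW hlog
    have := Pstar_nonneg L
    simp
    positivity
  have e1 : Pstar (48 * s) ≤ 36864 * (W * Real.log (1 + W)) :=
    calc Pstar (48 * s) ≤ Pstar (192 * W) :=
          Pstar_mono (by positivity) (by linarith [hsW hq0])
      _ ≤ 192 ^ 2 * Pstar W := Pstar_mul_le_sq (by norm_num) hW
      _ ≤ 192 ^ 2 * (W * Real.log (1 + W)) := by
          have := Pstar_le_mul_log hW
          gcongr
      _ = _ := by ring
  have e2 : Pstar (16 * |L|) ≤ 256 * Pstar L := by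
    have := Pstar_mul_le_sq (l := 16) (by norm_num) (abs_nonneg L)
    rw [Pstar_abs] at this
    linarith
  have hinv : 1 ≤ q⁻¹ := (one_le_inv₀ hq0).2 hq1
  have y1 : 12 * q ^ 2 * s * c ≤ q ^ 4 * (Real.exp c - 1 - c) / 4 + Pstar (48 * s) / 4 := by
    have h := mul_le_exp_add_Pstar c (b := q⁻¹ ^ 2 * (48 * s)) (by positivity)
    have h2 := Pstar_mul_le_sq (l := q⁻¹ ^ 2) (t := 48 * s) (one_le_pow₀ hinv) (by positivity)
    have h3 := mul_le_mul_of_nonneg_left (h.trans (add_le_add_right h2 _)) (pow_nonneg hq 4)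
    have e3 : q ^ 4 * (c * (q⁻¹ ^ 2 * (48 * s))) = 48 * q ^ 2 * s * c := by
      field_simp
    have e4 : q ^ 4 * ((Real.exp c - 1 - c) + (q⁻¹ ^ 2) ^ 2 * Pstar (48 * s)) =
        q ^ 4 * (Real.exp c - 1 - c) + Pstar (48 * s) := by
      field_simp
    rw [e3, e4] at h3
    linarith
  have y2 : 4 * q ^ 3 * |L| * c ≤ q ^ 4 * (Real.exp c - 1 - c) / 4 + Pstar (16 * |L|) / 4 := by
    have h := mul_le_exp_add_Pstar c (b := q⁻¹ * (16 * |L|)) (by positivity)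
    have h2 := Pstar_mul_le_sq (l := q⁻¹) (t := 16 * |L|) hinv (by positivity)
    have h3 := mul_le_mul_of_nonneg_left (h.trans (add_le_add_right h2 _)) (pow_nonneg hq 4)
    have e3 : q ^ 4 * (c * (q⁻¹ * (16 * |L|))) = 16 * q ^ 3 * |L| * c := by
      field_simp
    have e4 : q ^ 4 * ((Real.exp c - 1 - c) + q⁻¹ ^ 2 * Pstar (16 * |L|)) =
        q ^ 4 * (Real.exp c - 1 - c) + q ^ 2 * Pstar (16 * |L|) := by
      field_simp
    have e5 : q ^ 2 * Pstar (16 * |L|) ≤ Pstar (16 * |L|) :=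
      mul_le_of_le_one_left (Pstar_nonneg _) (pow_le_one₀ hq hq1)
    rw [e3, e4] at h3
    linarith
  have y3 : -(4 * q ^ 3 * L * c) ≤ 4 * q ^ 3 * |L| * c := by
    have := mul_le_mul_of_nonneg_left (neg_abs_le L) (show 0 ≤ 4 * q ^ 3 * c by positivity)
    linarith
  linarith

end Truncations

section CutoffDivergence

open Set Filter Topology

theorem continuous_indicator_of_eventually_zero {E : Type*} [TopologicalSpace E] {D : Set E}
    {g : E → ℝ} (hD : IsOpen D) (hg : ∀ x ∈ D, ContinuousAt g x)
    (hz : ∀ x, x ∉ D → ∀ᶠ y in 𝓝 x, y ∈ D → g y = 0) : Continuous (D.indicator g) := by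
  refine continuous_iff_continuousAt.2 fun x => ?_
  by_cases hx : x ∈ D
  · refine (hg x hx).congr ?_
    filter_upwards [hD.mem_nhds hx] with y hy
    rw [indicator_of_mem hy]
  · refine (continuousAt_const (y := (0 : ℝ))).congr ?_
    filter_upwards [hz x hx] with y hy
    by_cases hyD : y ∈ D
    · rw [indicator_of_mem hyD, hy hyD]
    · rw [indicator_of_notMem hyD]

theorem hasLineDerivAt_indicator_of_eventually_zero {E : Type*} [NormedAddCommGroup E]
    [NormedSpace ℝ E] {D : Set E} {g g' : E → ℝ} {v : E} (hD : IsOpen D)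
    (hg : ∀ x ∈ D, HasLineDerivAt ℝ g (g' x) x v)
    (hz : ∀ x, x ∉ D → ∀ᶠ y in 𝓝 x, y ∈ D → g y = 0) (x : E) :
    HasLineDerivAt ℝ (D.indicator g) (D.indicator g' x) x v := by
  by_cases hx : x ∈ D
  · rw [indicator_of_mem hx]
    refine (hg x hx).congr_of_eventuallyEq ?_
    filter_upwards [hD.mem_nhds hx] with y hy
    rw [indicator_of_mem hy]
  · rw [indicator_of_notMem hx]
    have h0 : HasLineDerivAt ℝ (fun _ : E => (0 : ℝ)) 0 x v := hasDerivAt_const _ _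
    refine h0.congr_of_eventuallyEq ?_
    filter_upwards [hz x hx] with y hy
    by_cases hyD : y ∈ D
    · rw [indicator_of_mem hyD, hy hyD]
    · rw [indicator_of_notMem hyD]

theorem isCC_indicator {E : Type*} [NormedAddCommGroup E] [ProperSpace E] {D : Set E}
    {g : E → ℝ} (hD : IsOpen D) (hb : Bornology.IsBounded D) (hg : ∀ x ∈ D, ContinuousAt g x)
    (hz : ∀ x, x ∉ D → ∀ᶠ y in 𝓝 x, y ∈ D → g y = 0) : IsCC (D.indicator g) :=
  ⟨continuous_indicator_of_eventually_zero hD hg hz,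
    HasCompactSupport.of_support_subset_isCompact hb.isCompact_closure
      (support_indicator_subset.trans subset_closure)⟩

variable {N : ℕ}

theorem contDiffAt_partialD {f : EuclideanSpace ℝ (Fin N) → ℝ} {x : EuclideanSpace ℝ (Fin N)}
    {m n : WithTop ℕ∞} (hf : ContDiffAt ℝ n f x) (hmn : m + 1 ≤ n) (i : Fin N) :
    ContDiffAt ℝ m (partialD i f) x :=
  (hf.fderiv_right hmn).clm_apply contDiffAt_const

/-- The divergence of the field `smoothPos w ∇ζ(f) - ζ(f) ∇(smoothPos w)`, where
`ζ(t) = max (1 - t) 0 ^ 4`, integrates to zero, provided that the field vanishes near the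
complement of `D`. -/
theorem exists_isCC_integral_eq_zero {D : Set (EuclideanSpace ℝ (Fin N))} (hD : IsOpen D)
    (hb : Bornology.IsBounded D) {f w : EuclideanSpace ℝ (Fin N) → ℝ} (hf : ContDiff ℝ 2 f)
    (hw : ∀ x ∈ D, ContDiffAt ℝ 2 w x)
    (hz : ∀ x, x ∉ D → ∀ᶠ y in 𝓝 x, y ∈ D → 1 ≤ f y ∨ w y ≤ 0) :
    IsCC (D.indicator fun x =>
      smoothPos (w x) * (12 * max (1 - f x) 0 ^ 2 * gradSq f x -
        4 * max (1 - f x) 0 ^ 3 * laplacian f x) -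
      max (1 - f x) 0 ^ 4 * (smoothPosDerivTwo (w x) * gradSq w x +
        smoothPosDeriv (w x) * laplacian w x)) ∧
    ∫ x, D.indicator (fun x =>
      smoothPos (w x) * (12 * max (1 - f x) 0 ^ 2 * gradSq f x -
        4 * max (1 - f x) 0 ^ 3 * laplacian f x) -
      max (1 - f x) 0 ^ 4 * (smoothPosDerivTwo (w x) * gradSq w x +
        smoothPosDeriv (w x) * laplacian w x)) x = 0 := by
  set q : EuclideanSpace ℝ (Fin N) → ℝ := fun x => max (1 - f x) 0 with hq
  set F : Fin N → EuclideanSpace ℝ (Fin N) → ℝ := fun i x =>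
    smoothPos (w x) * (-4 * q x ^ 3 * partialD i f x) -
      q x ^ 4 * (smoothPosDeriv (w x) * partialD i w x) with hF
  set F' : Fin N → EuclideanSpace ℝ (Fin N) → ℝ := fun i x =>
    smoothPos (w x) * (12 * q x ^ 2 * partialD i f x ^ 2 -
        4 * q x ^ 3 * partialD i (partialD i f) x) -
      q x ^ 4 * (smoothPosDerivTwo (w x) * partialD i w x ^ 2 +
        smoothPosDeriv (w x) * partialD i (partialD i w) x) with hF'
  have hq0 : ∀ x, 1 ≤ f x → q x = 0 := fun x hx => max_eq_right (by linarith)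
  have hFz : ∀ i x, x ∉ D → ∀ᶠ y in 𝓝 x, y ∈ D → F i y = 0 := fun i x hx => by
    filter_upwards [hz x hx] with y hy hyD
    rcases hy hyD with h | h
    · simp [hF, hq0 y h]
    · simp [hF, smoothPos_of_nonpos h, smoothPosDeriv_of_nonpos h]
  have hFz' : ∀ i x, x ∉ D → ∀ᶠ y in 𝓝 x, y ∈ D → F' i y = 0 := fun i x hx => by
    filter_upwards [hz x hx] with y hy hyD
    rcases hy hyD with h | h
    · simp [hF', hq0 y h]
    · simp [hF', smoothPos_of_nonpos h, smoothPosDeriv_of_nonpos h, smoothPosDerivTwo_of_nonpos h]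
  have cq : Continuous q := (continuous_const.sub hf.continuous).max continuous_const
  have c0 : Continuous smoothPos :=
    continuous_iff_continuousAt.2 fun t => (hasDerivAt_smoothPos t).continuousAt
  have c1 : Continuous smoothPosDeriv :=
    continuous_iff_continuousAt.2 fun t => (hasDerivAt_smoothPosDeriv t).continuousAt
  have hw1 : ∀ i, ∀ x ∈ D, ContDiffAt ℝ 1 (partialD i w) x := fun i x hx =>
    contDiffAt_partialD (hw x hx) (by norm_num) i
  have hw2 : ∀ i, ∀ x ∈ D, ContinuousAt (partialD i (partialD i w)) x := fun i x hx =>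
    (contDiffAt_partialD (m := 0) (hw1 i x hx) (by norm_num) i).continuousAt
  have k0 : ∀ x ∈ D, ContinuousAt (fun x => smoothPos (w x)) x := fun x hx =>
    c0.continuousAt.comp (hw x hx).continuousAt
  have k1 : ∀ x ∈ D, ContinuousAt (fun x => smoothPosDeriv (w x)) x := fun x hx =>
    c1.continuousAt.comp (hw x hx).continuousAt
  have k2 : ∀ x ∈ D, ContinuousAt (fun x => smoothPosDerivTwo (w x)) x := fun x hx =>
    continuous_smoothPosDerivTwo.continuousAt.comp (hw x hx).continuousAt
  have cd : ∀ i, Continuous (partialD i f) := fun i => (hf.partialD i).continuous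
  have cdd : ∀ i, Continuous (partialD i (partialD i f)) := fun i =>
    continuous_partialD (hf.partialD i) i
  have hFc : ∀ i, IsCC (D.indicator (F i)) := fun i =>
    isCC_indicator hD hb (fun x hx => ((k0 x hx).mul
      (((continuous_const.mul (cq.pow 3)).mul (cd i)).continuousAt)).sub
      ((cq.pow 4).continuousAt.mul ((k1 x hx).mul (hw1 i x hx).continuousAt))) (hFz i)
  have hFc' : ∀ i, IsCC (D.indicator (F' i)) := fun i =>
    isCC_indicator hD hb (fun x hx => ((k0 x hx).mul
      (((continuous_const.mul (cq.pow 2)).mul ((cd i).pow 2)).sub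
        ((continuous_const.mul (cq.pow 3)).mul (cdd i))).continuousAt).sub
      ((cq.pow 4).continuousAt.mul (((k2 x hx).mul ((hw1 i x hx).continuousAt.pow 2)).add
        ((k1 x hx).mul (hw2 i x hx))))) (hFz' i)
  have hFd : ∀ i, ∀ x ∈ D, HasLineDerivAt ℝ (F i) (F' i x) x (EuclideanSpace.single i 1) := by
    intro i x hx
    have df := hasLineDerivAt_partialD (hf.differentiable (by norm_num) x) i
    have dw := hasLineDerivAt_partialD ((hw x hx).differentiableAt (by norm_num)) i
    have ddf := hasLineDerivAt_partialD ((hf.partialD i).differentiable (by norm_num) x) i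
    have ddw := hasLineDerivAt_partialD ((hw1 i x hx).differentiableAt (by norm_num)) i
    have h3 := HasLineDerivAt.comp_real (hasDerivAt_max_one_sub_pow 1 (f x)) df
    have h4 := HasLineDerivAt.comp_real (hasDerivAt_max_one_sub_pow 2 (f x)) df
    have h := ((HasLineDerivAt.comp_real (hasDerivAt_smoothPos (w x)) dw).mul_real
      (((HasLineDerivAt.comp_real (φ := fun t => -4 * t)
        (by simpa using (hasDerivAt_id _).const_mul (-4 : ℝ)) h3)).mul_real ddf)).sub_real
      (h4.mul_real ((HasLineDerivAt.comp_real (hasDerivAt_smoothPosDeriv (w x)) dw).mul_real ddw))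
    refine h.congr_deriv ?_
    simp only [hF', hq]
    push_cast
    ring
  have hsum : (D.indicator fun x =>
      smoothPos (w x) * (12 * q x ^ 2 * gradSq f x - 4 * q x ^ 3 * laplacian f x) -
      q x ^ 4 * (smoothPosDerivTwo (w x) * gradSq w x +
        smoothPosDeriv (w x) * laplacian w x)) = fun x => ∑ i, D.indicator (F' i) x := by
    ext x
    by_cases hx : x ∈ D
    · simp only [indicator_of_mem hx, hF', Finset.sum_sub_distrib, ← Finset.mul_sum,
        Finset.sum_add_distrib, laplacian_eq, gradSq]
    · simp only [indicator_of_notMem hx, Finset.sum_const_zero]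
  rw [hsum]
  refine ⟨IsCC.sum _ fun i _ => hFc' i, ?_⟩
  rw [integral_finsetSum _ fun i _ => (hFc' i).integrable]
  exact Finset.sum_eq_zero fun i _ => integral_eq_zero_of_hasLineDerivAt (hFc i).integrable
    (hFc' i).integrable (hasLineDerivAt_indicator_of_eventually_zero hD (hFd i) (hFz i))

theorem two_mul_integral_eq {f : EuclideanSpace ℝ (Fin N) → ℝ} (hf : ContDiff ℝ 2 f)
    (hc : HasCompactSupport f) :
    2 * N * ∫ x, f x = ∫ x, ‖x‖ ^ 2 * laplacian f x := by
  have hd := isCC_partialD hf hc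
  have hdd := isCC_partialD_partialD hf hc
  have hfc : IsCC f := ⟨hf.continuous, hc⟩
  have hn : Continuous fun x : EuclideanSpace ℝ (Fin N) => ‖x‖ ^ 2 := by fun_prop
  have hx : ∀ i : Fin N, Continuous fun x : EuclideanSpace ℝ (Fin N) => 2 * x i := fun i => by
    fun_prop
  have hF : ∀ i, IsCC fun x : EuclideanSpace ℝ (Fin N) =>
      ‖x‖ ^ 2 * partialD i f x - 2 * x i * f x := fun i =>
    (IsCC.mul_left hn (hd i)).sub (IsCC.mul_left (hx i) hfc)
  have hF' : ∀ i, IsCC fun x : EuclideanSpace ℝ (Fin N) =>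
      ‖x‖ ^ 2 * partialD i (partialD i f) x - 2 * f x := fun i =>
    (IsCC.mul_left hn (hdd i i)).sub (hfc.const_mul 2)
  have hz : ∀ i, ∫ x : EuclideanSpace ℝ (Fin N),
      (‖x‖ ^ 2 * partialD i (partialD i f) x - 2 * f x) = 0 := fun i => by
    refine integral_eq_zero_of_hasLineDerivAt (v := EuclideanSpace.single i 1)
      (hF i).integrable (hF' i).integrable fun x => ?_
    have h1 : HasLineDerivAt ℝ (fun y : EuclideanSpace ℝ (Fin N) => ‖y‖ ^ 2) (2 * x i) x
        (EuclideanSpace.single i 1) := by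
      have := (hasStrictFDerivAt_norm_sq x).hasFDerivAt.hasLineDerivAt (EuclideanSpace.single i 1)
      simpa [EuclideanSpace.inner_single_right] using this
    have h2 : HasLineDerivAt ℝ (fun y : EuclideanSpace ℝ (Fin N) => 2 * y i) 2 x
        (EuclideanSpace.single i 1) := by
      have := ((EuclideanSpace.proj (𝕜 := ℝ) i).hasFDerivAt (x := x)).hasLineDerivAt
        (EuclideanSpace.single i 1)
      refine HasDerivAt.congr_deriv (HasLineDerivAt.comp_real (φ := fun t => 2 * t)
        (by simpa using (hasDerivAt_id _).const_mul (2 : ℝ)) this) ?_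
      simp
    refine HasDerivAt.congr_deriv ((h1.mul_real (hasLineDerivAt_partialD
      ((hf.partialD i).differentiable (by norm_num) x) i)).sub_real (h2.mul_real
      (hasLineDerivAt_partialD (hf.differentiable (by norm_num) x) i))) ?_
    ring
  have hs : ∫ x : EuclideanSpace ℝ (Fin N), (‖x‖ ^ 2 * laplacian f x - 2 * N * f x) = 0 := by
    refine Eq.trans ?_ (Finset.sum_eq_zero (s := Finset.univ) fun i _ => hz i)
    rw [← integral_finsetSum _ fun i _ => (hF' i).integrable]
    congr 1
    ext x
    rw [laplacian_eq, Finset.sum_sub_distrib, ← Finset.mul_sum]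
    simp
    ring
  rw [integral_sub (IsCC.mul_left hn (isCC_laplacian hf hc)).integrable
    (hfc.const_mul _).integrable, integral_const_mul] at hs
  linarith

end CutoffDivergence

section Removability

open Set Filter Topology

variable {N : ℕ}

theorem one_sub_four_mul_le_max_pow (t : ℝ) : 1 - 4 * t ≤ max (1 - t) 0 ^ 4 := by
  have h1 := one_add_mul_le_pow (a := max (1 - t) 0 - 1)
    (by linarith [le_max_right (1 - t) 0]) 4
  have h2 := le_max_left (1 - t) 0
  rw [add_sub_cancel] at h1
  push_cast at h1
  linarith

theorem measure_mul_le_of_cutoff {D : Set (EuclideanSpace ℝ (Fin N))} (hD : IsOpen D)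
    (hb : Bornology.IsBounded D) {f w g : EuclideanSpace ℝ (Fin N) → ℝ} (hf : ContDiff ℝ 2 f)
    (hc : HasCompactSupport f) (h0 : ∀ x, 0 ≤ f x) (hw : ∀ x ∈ D, ContDiffAt ℝ 2 w x)
    (hz : ∀ x, x ∉ D → ∀ᶠ y in 𝓝 x, y ∈ D → 1 ≤ f y ∨ w y ≤ 0)
    (hlap : ∀ x ∈ D, laplacian w x = g x) (hg : ∀ x ∈ D, Real.exp (w x) - 1 ≤ g x)
    (hg0 : ∀ x ∈ D, 0 ≤ g x) {B : Set (EuclideanSpace ℝ (Fin N))} (hB : MeasurableSet B)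
    (hBD : B ⊆ D) {a : ℝ} (ha : 0 ≤ a) (haB : ∀ x ∈ B, a ≤ smoothPosDeriv (w x) * g x) :
    volume.real B * (a / 2) ≤ 9216 * ((128 * (2 * N + 1) * N ^ 2 + 1) *
      ((∫ x, Pstar (laplacian f x)) + ∫ x, |laplacian f x|)) +
      64 * (∫ x, Pstar (laplacian f x)) + 2 * a * ∫ x, f x := by
  obtain ⟨hG, hG0⟩ := exists_isCC_integral_eq_zero hD hb hf hw hz
  set G : EuclideanSpace ℝ (Fin N) → ℝ := D.indicator fun x =>
      smoothPos (w x) * (12 * max (1 - f x) 0 ^ 2 * gradSq f x -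
        4 * max (1 - f x) 0 ^ 3 * laplacian f x) -
      max (1 - f x) 0 ^ 4 * (smoothPosDerivTwo (w x) * gradSq w x +
        smoothPosDeriv (w x) * laplacian w x) with hGdef
  set W : EuclideanSpace ℝ (Fin N) → ℝ := fun x => (1 + f x)⁻¹ ^ 2 * gradSq f x with hWdef
  have hW : ∀ x, 0 ≤ W x := fun x => mul_nonneg (sq_nonneg _) (gradSq_nonneg _ _)
  have hWc : IsCC W :=
    IsCC.mul_left ((continuous_inv_one_add hf.continuous h0).pow 2) (isCC_gradSq hf hc)
  have hWL : IsCC fun x => W x * Real.log (1 + W x) := by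
    have : Continuous fun x => Real.log (1 + W x) :=
      (continuous_const.add hWc.1).log fun x => (add_pos_of_pos_of_nonneg one_pos (hW x)).ne'
    simpa only [mul_comm] using IsCC.mul_left this hWc
  have hP : IsCC fun x => Pstar (laplacian f x) :=
    (isCC_laplacian hf hc).comp continuous_Pstar Pstar_zero
  have hfc : IsCC f := ⟨hf.continuous, hc⟩
  have hR : ∀ x, 0 ≤ 9216 * (W x * Real.log (1 + W x)) + 64 * Pstar (laplacian f x) := fun x => by
    have := Real.log_nonneg (show 1 ≤ 1 + W x by linarith [hW x])
    have := Pstar_nonneg (laplacian f x)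
    have := hW x
    positivity
  have hkey : ∀ x ∈ D, max (1 - f x) 0 ^ 4 * (smoothPosDeriv (w x) * g x) / 2 ≤
      9216 * (W x * Real.log (1 + W x)) + 64 * Pstar (laplacian f x) - G x := by
    intro x hx
    rw [hGdef, indicator_of_mem hx, hlap x hx]
    have hq := le_max_right (1 - f x) 0
    have y := young_cutoff (c := smoothPos (w x)) (s := gradSq f x) (W := W x)
      (L := laplacian f x) hq (max_le (by linarith [h0 x]) zero_le_one) (smoothPos_nonneg _)
      (gradSq_nonneg f x) (hW x) fun hpos => by
        have hf1 : f x < 1 := by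
          by_contra! h
          rw [max_eq_right (by linarith)] at hpos
          exact lt_irrefl _ hpos
        have hfp : 0 < 1 + f x := by linarith [h0 x]
        have h2 : (1 + f x) ^ 2 ≤ 4 := by nlinarith [h0 x]
        have h3 : gradSq f x = (1 + f x) ^ 2 * W x := by
          rw [hWdef]
          field_simp
        rw [h3]
        exact mul_le_mul_of_nonneg_right h2 (hW x)
    have h1 := exp_smoothPos_sub_one_le (w x)
    have h2 := mul_le_mul_of_nonneg_left (hg x hx) (smoothPosDeriv_nonneg (w x))
    have h3 := smoothPos_nonneg (w x)
    have h4 : Real.exp (smoothPos (w x)) - 1 - smoothPos (w x) ≤ smoothPosDeriv (w x) * g x := by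
      linarith
    have hq4 : 0 ≤ max (1 - f x) 0 ^ 4 := pow_nonneg hq 4
    have h5 := mul_le_mul_of_nonneg_left h4 hq4
    have h6 : 0 ≤ max (1 - f x) 0 ^ 4 * (smoothPosDerivTwo (w x) * gradSq w x) :=
      mul_nonneg hq4 (mul_nonneg (smoothPosDerivTwo_nonneg _) (gradSq_nonneg _ _))
    linarith
  have hRG : ∀ x, 0 ≤
      9216 * (W x * Real.log (1 + W x)) + 64 * Pstar (laplacian f x) - G x := by
    intro x
    by_cases hx : x ∈ D
    · refine le_trans ?_ (hkey x hx)
      have := mul_nonneg (smoothPosDeriv_nonneg (w x)) (hg0 x hx)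
      have := le_max_right (1 - f x) 0
      positivity
    · rw [hGdef, indicator_of_notMem hx, sub_zero]
      exact hR x
  have hBb : volume B ≠ ∞ := (hb.subset hBD).measure_lt_top.ne
  have hle : ∫ x, B.indicator (fun _ => a / 2) x ≤ ∫ x,
      (9216 * (W x * Real.log (1 + W x)) + 64 * Pstar (laplacian f x) - G x + 2 * a * f x) := by
    refine integral_mono ((integrable_indicator_iff hB).2 (integrableOn_const hBb))
      ((((hWL.const_mul 9216).add (hP.const_mul 64)).sub hG).add (hfc.const_mul _)).integrable
      fun x => ?_
    by_cases hx : x ∈ B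
    · simp only [indicator_of_mem hx]
      have h1 := hkey x (hBD hx)
      have h2 : (1 - 4 * f x) * a ≤ max (1 - f x) 0 ^ 4 * (smoothPosDeriv (w x) * g x) :=
        (mul_le_mul_of_nonneg_right (one_sub_four_mul_le_max_pow (f x)) ha).trans
          (mul_le_mul_of_nonneg_left (haB x hx) (pow_nonneg (le_max_right _ _) 4))
      linarith
    · simp only [indicator_of_notMem hx]
      exact add_nonneg (hRG x) (mul_nonneg (by positivity) (h0 x))
  rw [integral_indicator hB, setIntegral_const, smul_eq_mul,
    integral_add (((hWL.const_mul 9216).add (hP.const_mul 64)).sub hG).integrable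
      (hfc.const_mul _).integrable,
    integral_sub ((hWL.const_mul 9216).add (hP.const_mul 64)).integrable hG.integrable, hG0,
    integral_add (hWL.const_mul 9216).integrable (hP.const_mul 64).integrable,
    integral_const_mul, integral_const_mul, integral_const_mul, sub_zero] at hle
  have hlog := integral_gradSq_log_le hf hc h0
  have := mul_le_mul_of_nonneg_left hlog (show (0 : ℝ) ≤ 9216 by norm_num)
  linarith

theorem laplacian_eq_zero_of_notMem_tsupport {f : EuclideanSpace ℝ (Fin N) → ℝ}
    {x : EuclideanSpace ℝ (Fin N)} (hx : x ∉ tsupport f) : laplacian f x = 0 := by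
  rw [laplacian_eq]
  refine Finset.sum_eq_zero fun i _ => image_eq_zero_of_notMem_tsupport fun h => hx ?_
  exact (tsupport_fderiv_apply_subset ℝ _).trans (tsupport_fderiv_apply_subset ℝ _) h

theorem exists_of_capDLlnL_eq_zero {Ω K : Set (EuclideanSpace ℝ (Fin N))}
    (hΩb : Bornology.IsBounded Ω) (hcap : capDLlnL Ω K = 0) {k : ℝ} (hk : 0 < k) (hk1 : k ≤ 1) :
    ∃ f : EuclideanSpace ℝ (Fin N) → ℝ, ContDiff ℝ 2 f ∧ HasCompactSupport f ∧ tsupport f ⊆ Ω ∧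
      (∀ x, 0 ≤ f x) ∧ (∃ U, IsOpen U ∧ K ⊆ U ∧ ∀ x ∈ U, 1 ≤ f x) ∧
      ∫ x, Pstar (laplacian f x) ≤ k ∧ ∫ x, |laplacian f x| ≤ k * (1 + volume.real Ω) := by
  have hlt : capDLlnL Ω K < ENNReal.ofReal k := by
    rw [hcap]
    exact ENNReal.ofReal_pos.2 hk
  obtain ⟨c, ⟨f, hf, hc, hs, h0, hU, rfl⟩, hck⟩ := sInf_lt_iff.1 hlt
  obtain ⟨_, ⟨l, ⟨hl, hlint⟩, rfl⟩, hlk⟩ := sInf_lt_iff.1 hck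
  have hlk' : l < k := (ENNReal.ofReal_lt_ofReal_iff hk).1 hlk
  refine ⟨f, hf, hc, hs, h0, hU, ?_⟩
  have hlap := isCC_laplacian hf hc
  have hQ : IsCC fun x => Pstar (laplacian f x / l) :=
    (hlap.div_const l).comp continuous_Pstar Pstar_zero
  have hP : IsCC fun x => Pstar (laplacian f x) := hlap.comp continuous_Pstar Pstar_zero
  have hQ1 : ∫ x in Ω, Pstar (laplacian f x / l) ≤ 1 := by
    rw [integral_eq_lintegral_of_nonneg_ae (Eventually.of_forall fun x => Pstar_nonneg _)
      hQ.1.aestronglyMeasurable]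
    exact ENNReal.toReal_le_of_le_ofReal zero_le_one (by simpa using hlint)
  have hout : ∀ x, x ∉ Ω → laplacian f x = 0 := fun x hx =>
    laplacian_eq_zero_of_notMem_tsupport fun h => hx (hs h)
  have hscale : ∀ x, l * (|laplacian f x| / l) = |laplacian f x| := fun x => by field_simp
  have habs : ∀ x, Pstar (|laplacian f x| / l) = Pstar (laplacian f x / l) := fun x => by
    rw [← Pstar_abs (laplacian f x / l), abs_div, abs_of_pos hl]
  constructor
  · rw [← setIntegral_eq_integral_of_forall_compl_eq_zero (s := Ω) fun x hx => by
      rw [hout x hx, Pstar_zero]]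
    calc ∫ x in Ω, Pstar (laplacian f x) ≤ ∫ x in Ω, l * Pstar (laplacian f x / l) := by
          refine integral_mono hP.integrable (hQ.const_mul l).integrable fun x => ?_
          have := Pstar_mul_le (k := l) (t := |laplacian f x| / l) hl (by linarith)
            (by positivity)
          rwa [hscale, habs, Pstar_abs] at this
      _ ≤ l * 1 := by
          rw [integral_const_mul]
          gcongr
      _ ≤ k := by linarith
  · rw [← setIntegral_eq_integral_of_forall_compl_eq_zero (s := Ω) fun x hx => by
      rw [hout x hx, abs_zero]]
    have hfin : volume Ω ≠ ∞ := hΩb.measure_lt_top.ne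
    calc ∫ x in Ω, |laplacian f x| ≤ ∫ x in Ω, l * (Pstar (laplacian f x / l) + 1) := by
          refine integral_mono hlap.abs.integrable
            ((hQ.integrable.add (integrableOn_const hfin)).const_mul l) fun x => ?_
          have := mul_le_mul_of_nonneg_left (abs_le_Pstar_add_one (laplacian f x / l)) hl.le
          rwa [abs_div, abs_of_pos hl, hscale] at this
      _ ≤ l * (1 + volume.real Ω) := by
          rw [integral_const_mul, integral_add hQ.integrable (integrableOn_const hfin),
            setIntegral_const, smul_eq_mul, mul_one]
          gcongr
      _ ≤ k * (1 + volume.real Ω) := by gcongr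

theorem integral_le_of_tsupport_subset_closedBall {f : EuclideanSpace ℝ (Fin N) → ℝ}
    (hf : ContDiff ℝ 2 f) (hc : HasCompactSupport f) (h0 : ∀ x, 0 ≤ f x) (hN : 1 ≤ N) {R : ℝ}
    (hR : tsupport f ⊆ Metric.closedBall 0 R) :
    ∫ x, f x ≤ R ^ 2 * ∫ x, |laplacian f x| := by
  have h1 : ∫ x, f x ≤ 2 * N * ∫ x, f x := by
    have : (1 : ℝ) ≤ N := by exact_mod_cast hN
    exact le_mul_of_one_le_left (integral_nonneg h0) (by linarith)
  rw [two_mul_integral_eq hf hc] at h1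
  refine h1.trans ?_
  rw [← integral_const_mul]
  have hlap := isCC_laplacian hf hc
  refine integral_mono (IsCC.mul_left (by fun_prop) hlap).integrable
    (hlap.abs.const_mul _).integrable fun x => ?_
  simp only
  by_cases hx : x ∈ tsupport f
  · have hxR : ‖x‖ ≤ R := by simpa using hR hx
    calc ‖x‖ ^ 2 * laplacian f x ≤ ‖x‖ ^ 2 * |laplacian f x| := by
          gcongr
          exact le_abs_self _
      _ ≤ R ^ 2 * |laplacian f x| := by gcongr
  · simp [laplacian_eq_zero_of_notMem_tsupport hx]

end Removability


/-- Theorem E: a compact `K ⊂ Ω` of zero `C_{ΔLlnL}`-capacity is removable: any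
nonnegative solution of `-Δu + e^u - 1 = 0` in `Ω ∖ K`, continuous up to
`closure Ω ∖ K` and vanishing on `∂Ω`, is identically zero on `Ω ∖ K`. -/
theorem removable_interior_singularity
    {N : ℕ} (Ω : Set (EuclideanSpace ℝ (Fin N)))
    (hΩo : IsOpen Ω) (hΩconn : IsConnected Ω) (hΩb : Bornology.IsBounded Ω)
    (K : Set (EuclideanSpace ℝ (Fin N))) (hK : IsCompact K) (hKΩ : K ⊆ Ω)
    (hcap : capDLlnL Ω K = 0)
    (u : EuclideanSpace ℝ (Fin N) → ℝ)
    (hu_cont : ContinuousOn u (closure Ω \ K))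
    (hu_C2 : ContDiffOn ℝ 2 u (Ω \ K))
    (hu_nonneg : ∀ x ∈ Ω \ K, 0 ≤ u x)
    (hu_eq : ∀ x ∈ Ω \ K, -laplacian u x + Real.exp (u x) - 1 = 0)
    (hu_bd : ∀ x ∈ frontier Ω, u x = 0) :
    ∀ x ∈ Ω \ K, u x = 0 := by
  rcases Nat.eq_zero_or_pos N with rfl | hN
  · intro x hx
    have h := hu_eq x hx
    simp only [laplacian, Finset.univ_eq_empty, Finset.sum_empty, neg_zero, zero_add] at h
    exact Real.exp_eq_one_iff _ |>.1 (by linarith)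
  intro x₀ hx₀
  by_contra hne
  have hpos : 0 < u x₀ := lt_of_le_of_ne (hu_nonneg x₀ hx₀) (Ne.symm hne)
  obtain ⟨δ, hδ, hδu⟩ := exists_between hpos
  have hD : IsOpen (Ω \ K) := hΩo.sdiff hK.isClosed
  have hb : Bornology.IsBounded (Ω \ K) := hΩb.subset Set.sdiff_subset
  have hu : ∀ x ∈ Ω \ K, ContDiffAt ℝ 2 u x := fun x hx =>
    hu_C2.contDiffAt (hD.mem_nhds hx)
  have hlap : ∀ x ∈ Ω \ K, laplacian (fun y => u y - δ) x = Real.exp (u x) - 1 := fun x hx => by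
    have h : laplacian (fun y => u y - δ) x = laplacian u x := by
      simp only [laplacian, fderiv_sub_const]
    linarith [hu_eq x hx]
  have hcont : ContinuousAt (fun x => smoothPosDeriv (u x - δ) * (Real.exp (u x) - 1)) x₀ := by
    have h1 := (hu x₀ hx₀).continuousAt
    exact ((hasDerivAt_smoothPosDeriv _).continuousAt.comp (f := fun x => u x - δ)
      (h1.sub continuousAt_const)).mul ((Real.continuous_exp.continuousAt.comp h1).sub
        continuousAt_const)
  have hval : 0 < smoothPosDeriv (u x₀ - δ) * (Real.exp (u x₀) - 1) :=
    mul_pos (smoothPosDeriv_pos (by linarith)) (by linarith [Real.add_one_lt_exp hne])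
  obtain ⟨a, ha, hau⟩ := exists_between hval
  obtain ⟨r, hr, hball⟩ := Metric.eventually_nhds_iff_ball.1
    ((hcont.eventually (lt_mem_nhds hau)).and (hD.mem_nhds hx₀))
  obtain ⟨R, hR⟩ := hΩb.subset_closedBall 0
  set C : ℝ := 9216 * ((128 * (2 * N + 1) * N ^ 2 + 1) * (1 + (1 + volume.real Ω))) + 64 +
    2 * a * (R ^ 2 * (1 + volume.real Ω)) with hC
  have hC0 : 0 ≤ C := by
    have : 0 ≤ volume.real Ω := measureReal_nonneg
    positivity
  have hmain : ∀ k, 0 < k → k ≤ 1 →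
      volume.real (Metric.ball x₀ r) * (a / 2) ≤ k * C := by
    intro k hk hk1
    obtain ⟨f, hf, hc, hs, h0, ⟨U, hU, hKU, hU1⟩, hP, hA⟩ :=
      exists_of_capDLlnL_eq_zero hΩb hcap hk hk1
    have hz : ∀ x, x ∉ Ω \ K →
        ∀ᶠ y in nhds x, y ∈ Ω \ K → 1 ≤ f y ∨ u y - δ ≤ 0 := by
      intro x hx
      by_cases hxK : x ∈ K
      · filter_upwards [hU.mem_nhds (hKU hxK)] with y hy _
        exact Or.inl (hU1 y hy)
      have hxΩ : x ∉ Ω := fun h => hx ⟨h, hxK⟩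
      by_cases hxc : x ∈ closure Ω
      · have hxf : x ∈ frontier Ω := by
          rw [hΩo.frontier_eq]
          exact ⟨hxc, hxΩ⟩
        have h1 : ∀ᶠ y in nhdsWithin x (closure Ω \ K), u y < δ :=
          (hu_cont x ⟨hxc, hxK⟩).eventually (gt_mem_nhds (by rwa [hu_bd x hxf]))
        filter_upwards [eventually_nhdsWithin_iff.1 h1] with y hy hyD
        exact Or.inr (by linarith [hy ⟨subset_closure hyD.1, hyD.2⟩])
      · filter_upwards [isClosed_closure.isOpen_compl.mem_nhds hxc] with y hy hyD
        exact absurd (subset_closure hyD.1) hy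
    have h1 := measure_mul_le_of_cutoff hD hb hf hc h0
      (fun x hx => (hu x hx).sub contDiffAt_const) hz hlap
      (fun x _ => by linarith [Real.exp_le_exp.2 (sub_le_self (u x) hδ.le)])
      (fun x hx => by linarith [Real.add_one_le_exp (u x), hu_nonneg x hx])
      Metric.isOpen_ball.measurableSet (fun x hx => (hball x hx).2) ha.le
      (fun x hx => (hball x hx).1.le)
    have h2 := (integral_le_of_tsupport_subset_closedBall hf hc h0 hN (hs.trans hR)).trans
      (mul_le_mul_of_nonneg_left hA (sq_nonneg R))
    refine h1.trans ?_
    have h3 := mul_le_mul_of_nonneg_left (add_le_add hP hA)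
      (show (0 : ℝ) ≤ 9216 * (128 * (2 * N + 1) * N ^ 2 + 1) by positivity)
    have h4 := mul_le_mul_of_nonneg_left h2 (show 0 ≤ 2 * a by positivity)
    rw [hC]
    linarith
  have hm : 0 < volume.real (Metric.ball x₀ r) * (a / 2) :=
    mul_pos (ENNReal.toReal_pos (Metric.measure_ball_pos _ x₀ hr).ne' measure_ball_lt_top.ne)
      (half_pos ha)
  set m := volume.real (Metric.ball x₀ r) * (a / 2)
  have hlt : 0 < m + C + 1 := by linarith
  have h := hmain (m / (m + C + 1)) (div_pos hm hlt) ((div_le_one hlt).2 (by linarith))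
  rw [div_mul_eq_mul_div, le_div_iff₀ hlt] at h
  nlinarith
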